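/- arXiv:1006.5207 — 10 statements merged into one kernel-verified Lean document; each statement's English description precedes it below -/
import Mathlib

section
/- Let M be the generic v × v polynomial matrix associated to a degree pattern d with support S. Then det M ≠ 0 in K[s] if and only if there exists a permutation σ of Fin v with (i, σ i) ∈ S for all i, i.e., if and only if the bipartite graph of the pattern has a perfect matching. (This is the genericity statement: a structured square polynomial matrix is generically nonsingular exactly when its bipartite graph admits a perfect matching.) -/
/-- The generic polynomial matrix associated to a degree pattern
`d : Fin p × Fin v → Option ℕ`: the `(i,j)` entry is `0` when `d (i,j) = none`,
and is the generic degree-`k` polynomial `∑_{ℓ=0}^{k} X_{(i,j),ℓ} s^ℓ`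
(with independent indeterminate coefficients, viewed in the fraction field `K`
of the multivariate polynomial ring over `ℝ`) when `d (i,j) = some k`. -/
noncomputable def genericMatrix {p v : ℕ} (d : Fin p × Fin v → Option ℕ) :
    Matrix (Fin p) (Fin v)
      (Polynomial (FractionRing (MvPolynomial ((Fin p × Fin v) × ℕ) ℝ))) :=
  fun i j =>
    match d (i, j) with
    | none => 0
    | some k => ∑ ℓ ∈ Finset.range (k + 1),
        Polynomial.C (algebraMap (MvPolynomial ((Fin p × Fin v) × ℕ) ℝ)
            (FractionRing (MvPolynomial ((Fin p × Fin v) × ℕ) ℝ))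
            (MvPolynomial.X ((i, j), ℓ))) * Polynomial.X ^ ℓ

/-- A preimage of `genericMatrix d`, with coefficients in the polynomial ring itself
rather than in its fraction field. -/
noncomputable def genericMatrixPoly {p v : ℕ} (d : Fin p × Fin v → Option ℕ) :
    Matrix (Fin p) (Fin v) (Polynomial (MvPolynomial ((Fin p × Fin v) × ℕ) ℝ)) :=
  fun i j =>
    match d (i, j) with
    | none => 0
    | some k => ∑ ℓ ∈ Finset.range (k + 1),
        Polynomial.C (MvPolynomial.X ((i, j), ℓ)) * Polynomial.X ^ ℓ

theorem genericMatrix_eq_map {p v : ℕ} (d : Fin p × Fin v → Option ℕ) :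
    genericMatrix d = (genericMatrixPoly d).map (Polynomial.mapRingHom (algebraMap _ _)) := by
  ext1 i j
  simp only [genericMatrix, genericMatrixPoly, Matrix.map_apply]
  cases d (i, j) <;> simp

/-- Evaluating the indeterminates at the indicator of the constant coefficients on the graph
of `σ` turns the generic matrix into the permutation matrix of `σ`. -/
theorem genericMatrixPoly_map_eval_eq_permMatrix {v : ℕ} (d : Fin v × Fin v → Option ℕ)
    (σ : Equiv.Perm (Fin v)) (hσ : ∀ i, d (i, σ i) ≠ none) :
    (genericMatrixPoly d).map (Polynomial.mapRingHom (MvPolynomial.eval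
      fun x : (Fin v × Fin v) × ℕ => if σ x.1.1 = x.1.2 ∧ x.2 = 0 then (1 : ℝ) else 0)) =
      σ.permMatrix (Polynomial ℝ) := by
  ext1 i j
  simp only [genericMatrixPoly, Matrix.map_apply, Equiv.Perm.permMatrix,
    PEquiv.toMatrix_apply, Equiv.toPEquiv_apply, Option.mem_some_iff]
  by_cases h : σ i = j
  · obtain ⟨k, hk⟩ := Option.ne_none_iff_exists'.mp (hσ i)
    subst h
    simp [hk, apply_ite Polynomial.C, ite_mul]
  · cases d (i, j) <;> simp [h]

/-- A structured square polynomial matrix is generically nonsingular exactly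
when the bipartite graph of its pattern admits a perfect matching. -/
theorem genericMatrix_det_ne_zero_iff_perfect_matching {v : ℕ}
    (d : Fin v × Fin v → Option ℕ) :
    (genericMatrix d).det ≠ 0 ↔
      ∃ σ : Equiv.Perm (Fin v), ∀ i, d (i, σ i) ≠ none := by
  constructor
  · intro h
    rw [← Matrix.det_transpose, Matrix.det_apply'] at h
    obtain ⟨σ, -, hσ⟩ := Finset.exists_ne_zero_of_sum_ne_zero h
    refine ⟨σ, fun i hi => hσ ?_⟩
    rw [Finset.prod_eq_zero (Finset.mem_univ i) (by simp [genericMatrix, hi]), mul_zero]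
  · rintro ⟨σ, hσ⟩ h
    have hinj := Polynomial.map_injective _
      (IsFractionRing.injective (MvPolynomial ((Fin v × Fin v) × ℕ) ℝ)
        (FractionRing (MvPolynomial ((Fin v × Fin v) × ℕ) ℝ)))
    rw [genericMatrix_eq_map, ← RingHom.mapMatrix_apply, ← RingHom.map_det] at h
    have hdet : (genericMatrixPoly d).det = 0 := hinj (by simpa using h)
    have hperm := congrArg Matrix.det (genericMatrixPoly_map_eval_eq_permMatrix d σ hσ)
    rw [← RingHom.mapMatrix_apply, ← RingHom.map_det, hdet, map_zero,
      Matrix.det_permutation] at hperm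
    obtain hs | hs := Int.units_eq_one_or (Equiv.Perm.sign σ) <;> simp [hs] at hperm
end

section
/- Let M be the generic v × v polynomial matrix associated to a degree pattern d with support S, and assume S admits at least one perfect matching. Then det M is a unit of K[s] (equivalently, det M is a nonzero element of K, i.e., M is generically unimodular) if and only if every perfect matching of the pattern has weight zero, i.e., every permutation σ of Fin v with (i, σ i) ∈ S for all i satisfies d(i, σ i) = some 0 for all i. -/
open Polynomial in
/-- The generic matrix of a degree pattern, over the polynomial ring of its coefficients. -/
noncomputable def genericCoeffMatrix {v : ℕ} (d : Fin v × Fin v → Option ℕ) :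
    Matrix (Fin v) (Fin v) (MvPolynomial ((Fin v × Fin v) × ℕ) ℝ)[X] :=
  fun i j =>
    match d (i, j) with
    | none => 0
    | some k => ∑ ℓ ∈ Finset.range (k + 1), C (MvPolynomial.X ((i, j), ℓ)) * X ^ ℓ

theorem genericMatrix_det_eq_map {v : ℕ} (d : Fin v × Fin v → Option ℕ) :
    (genericMatrix d).det = (genericCoeffMatrix d).det.map (algebraMap _ _) := by
  rw [← Polynomial.coe_mapRingHom, RingHom.map_det]
  congr 1
  ext1 i j
  simp only [genericMatrix, genericCoeffMatrix, RingHom.mapMatrix_apply, Matrix.map_apply]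
  cases d (i, j) <;> simp

open Polynomial in
/-- Specializing the leading coefficients along a perfect matching to `1` and all other
coefficients to `0` turns the determinant into a signed monomial of degree the weight. -/
theorem exists_map_det_genericCoeffMatrix {v : ℕ} (d : Fin v × Fin v → Option ℕ)
    (σ : Equiv.Perm (Fin v)) (w : Fin v → ℕ) (hw : ∀ i, d (i, σ i) = some (w i)) :
    ∃ φ : MvPolynomial ((Fin v × Fin v) × ℕ) ℝ →+* ℝ,
      (genericCoeffMatrix d).det.map φ = X ^ (∑ i, w i) * ((Equiv.Perm.sign σ : ℤ) : ℝ[X]) := by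
  refine ⟨MvPolynomial.eval fun x => if σ x.1.1 = x.1.2 ∧ w x.1.1 = x.2 then 1 else 0, ?_⟩
  rw [← Polynomial.coe_mapRingHom, RingHom.map_det, ← Matrix.det_permutation,
    ← Finset.prod_pow_eq_pow_sum, ← Matrix.det_diagonal, ← Matrix.det_mul]
  congr 1
  ext1 i j
  simp only [genericCoeffMatrix, RingHom.mapMatrix_apply, Matrix.map_apply,
    Matrix.diagonal_mul, Equiv.Perm.permMatrix, PEquiv.toMatrix_apply, Equiv.toPEquiv_apply,
    Option.mem_def, Option.some.injEq]
  by_cases h : σ i = j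
  · subst h
    simp [hw, apply_ite (C : ℝ → ℝ[X]), ite_mul]
  · cases d (i, j) <;> simp [h]

theorem natDegree_det_genericCoeffMatrix_eq_zero {v : ℕ} (d : Fin v × Fin v → Option ℕ)
    (h : ∀ σ : Equiv.Perm (Fin v), (∀ i, d (i, σ i) ≠ none) → ∀ i, d (i, σ i) = some 0) :
    (genericCoeffMatrix d).det.natDegree = 0 := by
  rw [← Nat.le_zero, ← Matrix.det_transpose, Matrix.det_apply]
  refine Polynomial.natDegree_sum_le_of_forall_le _ _ fun σ _ => ?_
  refine (Polynomial.natDegree_smul_le _ _).trans ?_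
  by_cases hσ : ∀ i, d (i, σ i) ≠ none
  · refine (Polynomial.natDegree_prod_le _ _).trans (Finset.sum_eq_zero fun i _ => ?_).le
    simp [genericCoeffMatrix, h σ hσ i]
  · push Not at hσ
    obtain ⟨i, hi⟩ := hσ
    rw [Finset.prod_eq_zero (Finset.mem_univ i) (by simp [genericCoeffMatrix, hi])]
    simp

/-- Assuming the pattern admits a perfect matching, the generic square
polynomial matrix is generically unimodular (its determinant is a unit of
`K[s]`) if and only if every perfect matching of the pattern has weight
zero, i.e. uses only degree-zero entries. -/
theorem genericMatrix_isUnit_det_iff_all_matchings_weight_zero {v : ℕ}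
    (d : Fin v × Fin v → Option ℕ)
    (hmatch : ∃ σ : Equiv.Perm (Fin v), ∀ i, d (i, σ i) ≠ none) :
    IsUnit (genericMatrix d).det ↔
      ∀ σ : Equiv.Perm (Fin v), (∀ i, d (i, σ i) ≠ none) →
        ∀ i, d (i, σ i) = some 0 := by
  have hinj := IsFractionRing.injective (MvPolynomial ((Fin v × Fin v) × ℕ) ℝ)
    (FractionRing (MvPolynomial ((Fin v × Fin v) × ℕ) ℝ))
  have sign_ne (σ : Equiv.Perm (Fin v)) :
      ((Equiv.Perm.sign σ : ℤ) : Polynomial ℝ) ≠ 0 :=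
    Int.cast_ne_zero.mpr (Equiv.Perm.sign σ).ne_zero
  rw [genericMatrix_det_eq_map]
  constructor
  · intro hu σ hσ
    choose w hw using fun i => Option.ne_none_iff_exists'.mp (hσ i)
    obtain ⟨φ, hφ⟩ := exists_map_det_genericCoeffMatrix d σ w hw
    have hdeg := Polynomial.natDegree_eq_zero_of_isUnit hu
    rw [Polynomial.natDegree_map_eq_of_injective hinj] at hdeg
    have hle := Polynomial.natDegree_map_le (f := φ) (p := (genericCoeffMatrix d).det)
    rw [hφ, hdeg, Polynomial.natDegree_mul (pow_ne_zero _ Polynomial.X_ne_zero) (sign_ne σ),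
      Polynomial.natDegree_X_pow, Polynomial.natDegree_intCast, add_zero, Nat.le_zero,
      Finset.sum_eq_zero_iff] at hle
    intro i
    rw [hw, hle i (Finset.mem_univ i)]
  · intro h
    obtain ⟨σ, hσ⟩ := hmatch
    obtain ⟨φ, hφ⟩ := exists_map_det_genericCoeffMatrix d σ (fun _ => 0) (h σ hσ)
    have hdet : (genericCoeffMatrix d).det ≠ 0 := by
      intro h0
      rw [h0, Polynomial.map_zero] at hφ
      exact mul_ne_zero (pow_ne_zero _ Polynomial.X_ne_zero) (sign_ne σ) hφ.symm
    rw [Polynomial.isUnit_iff_degree_eq_zero, Polynomial.degree_map_eq_of_injective hinj,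
      Polynomial.degree_eq_natDegree hdet, natDegree_det_genericCoeffMatrix_eq_zero d h]
    rfl
end

section
/- Let F be a field, p ≤ v, and let M be a p × v matrix over F[s] whose nonzero entries all lie in a set S ⊆ Fin p × Fin v. Suppose (i₀, j₀) ∈ S is a redundant edge of S, i.e., there is no injective map f : Fin p → Fin v with (i, f i) ∈ S for all i and f i₀ = j₀. Let M' be the matrix obtained from M by replacing the (i₀, j₀) entry by 0. Then for every subset c of the columns with |c| = p, the p × p minor of M on the columns c equals the corresponding minor of M'. In particular M and M' have the same maximal minors and the same zero set. -/
/-- Removing a redundant edge does not change any maximal minor.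
Let `M` be a `p × v` polynomial matrix (`p ≤ v`) whose nonzero entries all lie
in the support `S`, and let `(i₀, j₀) ∈ S` be a redundant edge, i.e. no
`R`-saturating matching (injective `f : Fin p → Fin v` with `(i, f i) ∈ S` for
all `i`) satisfies `f i₀ = j₀`.  If `M'` is obtained from `M` by replacing the
`(i₀, j₀)` entry with `0`, then every `p × p` minor of `M` (on an injectively
chosen set of `p` columns) equals the corresponding minor of `M'`. -/
theorem minor_eq_of_redundant_edge_removed {F : Type*} [Field F] {p v : ℕ}
    (hpv : p ≤ v) (S : Set (Fin p × Fin v))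
    (M : Matrix (Fin p) (Fin v) (Polynomial F))
    (hsupp : ∀ i j, M i j ≠ 0 → (i, j) ∈ S)
    (i₀ : Fin p) (j₀ : Fin v) (hij : (i₀, j₀) ∈ S)
    (hred : ¬ ∃ f : Fin p → Fin v, Function.Injective f ∧
      (∀ i, (i, f i) ∈ S) ∧ f i₀ = j₀)
    (M' : Matrix (Fin p) (Fin v) (Polynomial F))
    (hM' : ∀ i j, M' i j = if i = i₀ ∧ j = j₀ then 0 else M i j) :
    ∀ c : Fin p → Fin v, Function.Injective c →
      (M.submatrix id c).det = (M'.submatrix id c).det := by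
  intro c hc
  rw [← Matrix.det_transpose, ← Matrix.det_transpose (M'.submatrix id c),
    Matrix.det_apply, Matrix.det_apply]
  refine Finset.sum_congr rfl fun σ _ => ?_
  congr 1
  simp only [Matrix.transpose_apply, Matrix.submatrix_apply, id_eq]
  by_cases hσ : c (σ i₀) = j₀
  · obtain ⟨i, hi⟩ : ∃ i, M i (c (σ i)) = 0 := by
      by_contra! h
      exact hred ⟨fun i => c (σ i), hc.comp σ.injective, fun i => hsupp _ _ (h i), hσ⟩
    rw [Finset.prod_eq_zero (Finset.mem_univ i) hi,
      Finset.prod_eq_zero (Finset.mem_univ i₀) (by simp [hM', hσ])]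
  · refine Finset.prod_congr rfl fun i _ => ?_
    rw [hM', if_neg]
    rintro ⟨rfl, h⟩
    exact hσ h
end

section
/- Let M be the generic p × v polynomial matrix (p ≤ v) associated to a degree pattern d with support S, and assume S admits at least one R-saturating matching. Then the p × p minors of M generate the unit ideal of K[s] (i.e., the zero set of M is generically empty, equivalently M(λ) has full row rank for every λ in any extension field) if and only if the following property P holds: whenever r ⊆ Fin p and c ⊆ Fin v are subsets with |r| = |c| such that every R-saturating matching f of S satisfies f(r) = c, every non-redundant edge (i,j) ∈ S with i ∈ r has d(i,j) = some 0. -/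
/-- An `R`-saturating matching of the support of the pattern `d`:
an injective map `f : Fin p → Fin v` with `(i, f i)` in the support for all `i`. -/
def IsRSatMatching {p v : ℕ} (d : Fin p × Fin v → Option ℕ) (f : Fin p → Fin v) : Prop :=
  Function.Injective f ∧ ∀ i, d (i, f i) ≠ none

/-- Evaluation of a degree pattern: the `(i, j)` entry is `∑_{ℓ ≤ k} x ((i, j), ℓ) * s ^ ℓ` when
`d (i, j) = some k`, and `0` when `d (i, j) = none`. -/
def patternMatrix {p v : ℕ} {A : Type*} [CommRing A] (d : Fin p × Fin v → Option ℕ)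
    (x : (Fin p × Fin v) × ℕ → A) (s : A) : Matrix (Fin p) (Fin v) A :=
  fun i j =>
    match d (i, j) with
    | none => 0
    | some k => ∑ ℓ ∈ Finset.range (k + 1), x ((i, j), ℓ) * s ^ ℓ

section patternMatrix

variable {p v : ℕ} {A B : Type*} [CommRing A] [CommRing B] {d : Fin p × Fin v → Option ℕ}
  {x : (Fin p × Fin v) × ℕ → A} {s : A}

lemma patternMatrix_of_eq_none {i : Fin p} {j : Fin v} (h : d (i, j) = none) :
    patternMatrix d x s i j = 0 := by
  simp [patternMatrix, h]

lemma patternMatrix_of_eq_some {i : Fin p} {j : Fin v} {k : ℕ} (h : d (i, j) = some k) :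
    patternMatrix d x s i j = ∑ ℓ ∈ Finset.range (k + 1), x ((i, j), ℓ) * s ^ ℓ := by
  simp [patternMatrix, h]

lemma map_patternMatrix (φ : A →+* B) :
    (patternMatrix d x s).map φ = patternMatrix d (φ ∘ x) (φ s) := by
  ext i j
  cases h : d (i, j) with
  | none => simp [patternMatrix_of_eq_none h]
  | some k => simp [patternMatrix_of_eq_some h]

end patternMatrix

lemma genericMatrix_eq_patternMatrix {p v : ℕ} (d : Fin p × Fin v → Option ℕ) :
    genericMatrix d = patternMatrix d
      (fun a => Polynomial.C (algebraMap (MvPolynomial ((Fin p × Fin v) × ℕ) ℝ)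
        (FractionRing (MvPolynomial ((Fin p × Fin v) × ℕ) ℝ)) (MvPolynomial.X a)))
      Polynomial.X :=
  rfl

/-- The pattern obtained from `d` by deleting the redundant edges. -/
noncomputable def nonredundantPattern {p v : ℕ} (d : Fin p × Fin v → Option ℕ) :
    Fin p × Fin v → Option ℕ := fun e =>
  open Classical in if ∃ f, IsRSatMatching d f ∧ f e.1 = e.2 then d e else none

lemma isRSatMatching_nonredundantPattern {p v : ℕ} {d : Fin p × Fin v → Option ℕ}
    {f : Fin p → Fin v} : IsRSatMatching (nonredundantPattern d) f ↔ IsRSatMatching d f := by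
  refine ⟨fun h => ⟨h.1, fun i hi => h.2 i ?_⟩, fun h => ⟨h.1, fun i => ?_⟩⟩
  · simp [nonredundantPattern, hi]
  · rw [nonredundantPattern, if_pos ⟨f, h, rfl⟩]
    exact h.2 i

lemma exists_isRSatMatching_of_nonredundantPattern_ne_none {p v : ℕ}
    {d : Fin p × Fin v → Option ℕ} {i : Fin p} {j : Fin v}
    (h : nonredundantPattern d (i, j) ≠ none) :
    ∃ f, IsRSatMatching (nonredundantPattern d) f ∧ f i = j := by
  simp_rw [isRSatMatching_nonredundantPattern]
  by_contra hne
  exact h (if_neg hne)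

/-- Deleting redundant edges does not change the maximal minors. -/
lemma det_submatrix_nonredundantPattern {p v : ℕ} {A : Type*} [CommRing A]
    (d : Fin p × Fin v → Option ℕ) (x : (Fin p × Fin v) × ℕ → A) (s : A)
    {e : Fin p → Fin v} (he : Function.Injective e) :
    ((patternMatrix (nonredundantPattern d) x s).submatrix id e).det =
      ((patternMatrix d x s).submatrix id e).det := by
  rw [Matrix.det_apply', Matrix.det_apply']
  refine Finset.sum_congr rfl fun σ _ => ?_
  congr 1
  by_cases h : ∀ i, d (σ i, e i) ≠ none
  · have hf : IsRSatMatching d (e ∘ σ.symm) :=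
      ⟨he.comp σ.symm.injective, fun i => by simpa using h (σ.symm i)⟩
    refine Finset.prod_congr rfl fun i _ => ?_
    have : nonredundantPattern d (σ i, e i) = d (σ i, e i) :=
      if_pos ⟨_, hf, by simp⟩
    simp [patternMatrix, this]
  · push Not at h
    obtain ⟨i, hi⟩ := h
    rw [Finset.prod_eq_zero (Finset.mem_univ i), Finset.prod_eq_zero (Finset.mem_univ i)]
    · exact patternMatrix_of_eq_none hi
    · exact patternMatrix_of_eq_none (by simp [nonredundantPattern, hi])

/-- The square matrix with the rows of `M` indexed by `r` and the rows of the identity matrix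
elsewhere. -/
def Matrix.rowExtension {n A : Type*} [DecidableEq n] [CommRing A] (r : Finset n)
    (M : Matrix n n A) : Matrix n n A :=
  fun i j => if i ∈ r then M i j else (1 : Matrix n n A) i j

lemma Matrix.map_rowExtension {n A B : Type*} [DecidableEq n] [CommRing A] [CommRing B]
    (r : Finset n) (M : Matrix n n A) (φ : A →+* B) :
    (M.rowExtension r).map φ = (M.map φ).rowExtension r := by
  ext i j
  by_cases hi : i ∈ r <;> simp [Matrix.rowExtension, hi, Matrix.one_apply, apply_ite φ]

open scoped Matrix in
/-- A matrix all of whose maximal minors vanish has a nonzero left kernel vector. -/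
lemma Matrix.exists_vecMul_eq_zero_of_forall_det_eq_zero {m n L : Type*} [Field L] [Fintype m]
    [DecidableEq m] [Fintype n] (M : Matrix m n L)
    (h : ∀ e : m → n, Function.Injective e → (M.submatrix id e).det = 0) :
    ∃ w : m → L, w ≠ 0 ∧ w ᵥ* M = 0 := by
  by_contra! hw
  have hrow : LinearIndependent L M.row := by
    rw [← Matrix.vecMul_injective_iff]
    refine (injective_iff_map_eq_zero M.vecMulLinear).2 fun w hw0 => ?_
    by_contra hne
    exact hw w hne hw0
  have hrank := hrow.rank_matrix
  obtain ⟨κ, a, ha, hspan, hli⟩ := exists_linearIndependent' L M.col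
  have := Fintype.ofInjective a ha
  have hcard : Fintype.card κ = Fintype.card m := by
    rw [linearIndependent_iff_card_eq_finrank_span.mp hli, Set.finrank, hspan,
      ← Matrix.rank_eq_finrank_span_cols, hrank]
  let ε := Fintype.equivOfCardEq hcard.symm
  have hunit : IsUnit (M.submatrix id (a ∘ ε)) := by
    rw [← Matrix.linearIndependent_cols_iff_isUnit]
    exact hli.comp ε ε.injective
  exact ((Matrix.isUnit_iff_isUnit_det _).1 hunit).ne_zero (h _ (ha.comp ε.injective))

open scoped Matrix in
lemma Matrix.det_submatrix_eq_zero_of_vecMul_eq_zero {m n A : Type*} [CommRing A] [IsDomain A]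
    [Fintype m] [DecidableEq m] {M : Matrix m n A} {w : m → A} (hw : w ≠ 0)
    (h : w ᵥ* M = 0) (e : m → n) : (M.submatrix id e).det = 0 :=
  Matrix.exists_vecMul_eq_zero_iff.1 ⟨w, hw, funext fun j => congrFun h (e j)⟩

/-- The size of an algebraically independent family is at most that of any finite set over which
it is algebraic. -/
lemma AlgebraicIndependent.card_le_of_isAlgebraic_adjoin {k L ι : Type*} [CommRing k]
    [Nontrivial k] [CommRing L] [IsDomain L] [Algebra k L] [FaithfulSMul k L] [Fintype ι] {y : ι → L}
    (hy : AlgebraicIndependent k y) (T : Finset L)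
    (h : ∀ i, IsAlgebraic (Algebra.adjoin k (T : Set L)) (y i)) :
    Fintype.card ι ≤ T.card := by
  have hind : (AlgebraicIndependent.matroid k L).Indep (Set.range y) :=
    hy.coe_range
  have hle := (AlgebraicIndependent.matroid k L).eRk_mono
    (show Set.range y ⊆ (AlgebraicIndependent.matroid k L).closure T by
      rw [AlgebraicIndependent.matroid_closure_eq]
      rintro _ ⟨i, rfl⟩
      exact h i)
  rw [Matroid.eRk_closure_eq, hind.eRk_eq_encard] at hle
  replace hle := hle.trans (Matroid.eRk_le_encard _ _)
  rw [← Set.image_univ, hy.injective.encard_image, Set.encard_univ,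
    Set.encard_coe_eq_coe_finsetCard] at hle
  simpa using hle

lemma Matrix.map_det_submatrix {m n A B : Type*} [Fintype m] [DecidableEq m] [CommRing A]
    [CommRing B] (φ : A →+* B) (M : Matrix m n A) (c : m → n) :
    φ (M.submatrix id c).det = ((M.map φ).submatrix id c).det := by
  rw [RingHom.map_det]
  rfl

lemma Matrix.map_det_rowExtension {m n A B : Type*} [Fintype m] [DecidableEq m] [CommRing A]
    [CommRing B] (φ : A →+* B) (M : Matrix m n A) (c : m → n) (r : Finset m) :
    φ ((M.submatrix id c).rowExtension r).det =
      (((M.map φ).submatrix id c).rowExtension r).det := by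
  rw [RingHom.map_det, Matrix.submatrix_map, ← Matrix.map_rowExtension]
  rfl

open scoped Matrix in
lemma Matrix.det_rowExtension_eq_zero_of_vecMul_eq_zero {m n A : Type*} [CommRing A] [IsDomain A]
    [Fintype m] [DecidableEq m] {M : Matrix m n A} {w : m → A} (hw : w ≠ 0)
    (h : w ᵥ* M = 0) (f : m → n) {r : Finset m} (hr : ∀ i ∉ r, w i = 0) :
    ((M.submatrix id f).rowExtension r).det = 0 := by
  refine Matrix.exists_vecMul_eq_zero_iff.1 ⟨w, hw, funext fun j => ?_⟩
  refine Eq.trans (Finset.sum_congr rfl fun i _ => ?_) (congrFun h (f j))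
  by_cases hi : i ∈ r
  · simp [Matrix.rowExtension, hi]
  · simp [hr i hi]

open scoped Matrix in
/-- If the rows of `M` in `r` are supported on the columns `f '' r`, then a linear relation among
those rows restricted to these columns is a linear relation among the rows of `M`. -/
lemma Matrix.exists_vecMul_eq_zero_of_det_rowExtension_eq_zero {m n A : Type*} [CommRing A]
    [IsDomain A] [Fintype m] [DecidableEq m] {M : Matrix m n A} {f : m → n}
    (hf : Function.Injective f) {r : Finset m}
    (hM : ∀ i ∈ r, ∀ j, (¬ ∃ i' ∈ r, f i' = j) → M i j = 0)
    (h : ((M.submatrix id f).rowExtension r).det = 0) :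
    ∃ w : m → A, w ≠ 0 ∧ w ᵥ* M = 0 := by
  obtain ⟨w, hw, hwB⟩ := Matrix.exists_vecMul_eq_zero_iff.2 h
  have hwr (j : m) (hj : j ∉ r) : w j = 0 := by
    have h := congrFun hwB j
    rw [Matrix.vecMul, dotProduct, Finset.sum_eq_single j] at h
    · simpa [Matrix.rowExtension, hj] using h
    · intro a _ haj
      by_cases ha : a ∈ r
      · have := hM a ha (f j) fun ⟨i', hi', h'⟩ => hj (hf h' ▸ hi')
        simp [Matrix.rowExtension, ha, this]
      · simp [Matrix.rowExtension, ha, haj]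
    · simp
  refine ⟨w, hw, funext fun j => ?_⟩
  by_cases hj : ∃ i' ∈ r, f i' = j
  · obtain ⟨i', -, rfl⟩ := hj
    refine Eq.trans (Finset.sum_congr rfl fun a _ => ?_) (congrFun hwB i')
    by_cases ha : a ∈ r
    · simp [Matrix.rowExtension, ha]
    · simp [hwr a ha]
  · refine Finset.sum_eq_zero fun a _ => ?_
    by_cases ha : a ∈ r
    · simp [hM a ha j hj]
    · simp [hwr a ha]

open scoped Matrix in
/-- If the columns of a pattern matrix with algebraically independent coefficients satisfy a
common linear relation `w`, then the rows in the support of `w` have at most as many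
neighbours as there are such rows. -/
lemma card_neighbors_le_card_support {p v : ℕ} {k L : Type*} [CommRing k] [Nontrivial k] [Field L]
    [Algebra k L] {d : Fin p × Fin v → Option ℕ} {x : (Fin p × Fin v) × ℕ → L}
    (hx : AlgebraicIndependent k x) {s : L} {w : Fin p → L} (hw : w ≠ 0)
    (h : w ᵥ* patternMatrix d x s = 0) (r : Finset (Fin p)) (hr : ∀ i, i ∈ r ↔ w i ≠ 0)
    (N : Finset (Fin v)) (hN : ∀ j ∈ N, ∃ i ∈ r, d (i, j) ≠ none) :
    N.card ≤ r.card := by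
  classical
  obtain ⟨i₀, hi₀⟩ := Function.ne_iff.1 hw
  let u : Fin p → L := fun i => (w i₀)⁻¹ * w i
  have hu : ∀ i ∈ r, u i ≠ 0 := fun i hi => mul_ne_zero (inv_ne_zero hi₀) ((hr i).1 hi)
  have hsum (j : Fin v) : ∑ i, u i * patternMatrix d x s i j = 0 := by
    have := congrFun h j
    simp only [Matrix.vecMul, dotProduct, Pi.zero_apply] at this
    simp only [u, mul_assoc, ← Finset.mul_sum, this, mul_zero]
  choose piv hpiv hpivd using fun j : N => hN j j.2
  let b : N → (Fin p × Fin v) × ℕ := fun j => ((piv j, (j : Fin v)), 0)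
  have hb : Function.Injective b := fun j j' hjj => by
    simp only [b, Prod.mk.injEq, and_true] at hjj
    exact Subtype.ext hjj.2
  let k₁ := Algebra.adjoin k (x '' (Set.range b)ᶜ)
  have hy : AlgebraicIndependent k₁ (x ∘ b) :=
    (hx.adjoin_of_disjoint (s := (Set.range b)ᶜ) (t := Set.range b) disjoint_compl_left).comp
      (fun j => ⟨b j, j, rfl⟩) fun j j' hjj => hb (congrArg Subtype.val hjj)
  let T : Finset L := insert s ((r.erase i₀).image u)
  have hT : T.card ≤ r.card := by
    refine (Finset.card_insert_le _ _).trans ?_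
    rw [← Finset.card_erase_add_one ((hr i₀).2 hi₀)]
    exact Nat.add_le_add_right Finset.card_image_le 1
  refine le_trans ?_ hT
  rw [← Fintype.card_coe]
  refine hy.card_le_of_isAlgebraic_adjoin T fun j => ?_
  let Ω : Subalgebra (Algebra.adjoin k₁ (T : Set L)) L :=
    Subalgebra.algebraicClosure (Algebra.adjoin k₁ (T : Set L)) L
  have hΩT (a : L) (ha : a ∈ T) : a ∈ Ω :=
    Ω.algebraMap_mem ⟨a, Algebra.subset_adjoin ha⟩
  have hsΩ : s ∈ Ω := hΩT s (Finset.mem_insert_self _ _)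
  have huΩ (i : Fin p) : u i ∈ Ω := by
    by_cases hi : i ∈ r
    · by_cases hii : i = i₀
      · have : u i = 1 := by rw [hii]; exact inv_mul_cancel₀ hi₀
        exact this ▸ Ω.one_mem
      · exact hΩT _ (Finset.mem_insert_of_mem
          (Finset.mem_image_of_mem u (Finset.mem_erase.2 ⟨hii, hi⟩)))
    · have : u i = 0 := by
        rw [hr, not_not] at hi
        simp [u, hi]
      exact this ▸ Ω.zero_mem
  have hxΩ (a) (ha : a ∉ Set.range b) : x a ∈ Ω := by
    have h₁ : x a ∈ k₁ := Algebra.subset_adjoin ⟨a, ha, rfl⟩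
    exact Ω.algebraMap_mem ⟨x a, (Algebra.adjoin k₁ (T : Set L)).algebraMap_mem ⟨x a, h₁⟩⟩
  let x' : (Fin p × Fin v) × ℕ → L := fun a => if a ∈ Set.range b then 0 else x a
  have hx'Ω (a) : x' a ∈ Ω := by
    by_cases ha : a ∈ Set.range b
    · simp only [x', if_pos ha, Ω.zero_mem]
    · simpa only [x', if_neg ha] using hxΩ a ha
  have hM'Ω (i : Fin p) : patternMatrix d x' s i j ∈ Ω := by
    cases hd : d (i, (j : Fin v)) with
    | none => exact patternMatrix_of_eq_none (x := x') (s := s) hd ▸ Ω.zero_mem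
    | some m =>
      rw [patternMatrix_of_eq_some hd]
      exact Ω.sum_mem fun ℓ _ => Ω.mul_mem (hx'Ω _) (Ω.pow_mem hsΩ ℓ)
  have hdiff (i : Fin p) : patternMatrix d x s i j - patternMatrix d x' s i j =
      if i = piv j then x (b j) else 0 := by
    cases hd : d (i, (j : Fin v)) with
    | none =>
      rw [patternMatrix_of_eq_none hd, patternMatrix_of_eq_none hd, if_neg, sub_zero]
      rintro rfl
      exact hpivd j hd
    | some m =>
      rw [patternMatrix_of_eq_some hd, patternMatrix_of_eq_some hd, ← Finset.sum_sub_distrib,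
        Finset.sum_eq_single_of_mem 0 (by simp)]
      · by_cases hi : i = piv j
        · have : ((i, (j : Fin v)), 0) = b j := by simp [b, hi]
          rw [this]
          simp only [x', if_pos (Set.mem_range_self j), if_pos hi, pow_zero, mul_one, sub_zero]
        · have : ((i, (j : Fin v)), 0) ∉ Set.range b := by
            rintro ⟨j', hj'⟩
            simp only [b, Prod.mk.injEq, and_true] at hj'
            obtain rfl : j' = j := Subtype.ext hj'.2
            exact hi hj'.1.symm
          simp only [x', if_neg this, if_neg hi, sub_self]
      · intro ℓ _ hℓ
        have : ((i, (j : Fin v)), ℓ) ∉ Set.range b := by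
          rintro ⟨j', hj'⟩
          simp only [b, Prod.mk.injEq] at hj'
          exact hℓ hj'.2.symm
        simp only [x', if_neg this, sub_self]
  have hkey : u (piv j) * x (b j) = -∑ i, u i * patternMatrix d x' s i j := by
    have : ∑ i, u i * (patternMatrix d x s i j - patternMatrix d x' s i j) =
        u (piv j) * x (b j) := by
      simp [hdiff]
    rw [← this]
    simp only [mul_sub, Finset.sum_sub_distrib, hsum, zero_sub]
  have hmem : u (piv j) * x (b j) ∈ Ω :=
    hkey ▸ Ω.neg_mem (Ω.sum_mem fun i _ => Ω.mul_mem (huΩ i) (hM'Ω i))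
  have hinv : IsAlgebraic (Algebra.adjoin k₁ (T : Set L)) (u (piv j))⁻¹ :=
    IsAlgebraic.inv (huΩ _)
  have := IsAlgebraic.mul hinv hmem
  rwa [inv_mul_cancel_left₀ (hu _ (hpiv j))] at this

open Polynomial in
/-- The determinant of the generic matrix restricted to the columns of a matching and to the rows
of `r` is nonzero, of degree at least that of each matching edge. -/
lemma det_rowExtension_genericMatrix {p v : ℕ} {d : Fin p × Fin v → Option ℕ} {f : Fin p → Fin v}
    (hf : IsRSatMatching d f) (r : Finset (Fin p)) :
    (((genericMatrix d).submatrix id f).rowExtension r).det ≠ 0 ∧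
      ∀ i ∈ r, ∀ k, d (i, f i) = some k →
        k ≤ (((genericMatrix d).submatrix id f).rowExtension r).det.natDegree := by
  let R := MvPolynomial ((Fin p × Fin v) × ℕ) ℝ
  let B₀ : Matrix (Fin p) (Fin p) R[X] :=
    ((patternMatrix d (fun a => C (MvPolynomial.X a : R)) X).submatrix id f).rowExtension r
  have hB : ((genericMatrix d).submatrix id f).rowExtension r =
      B₀.map (mapRingHom (algebraMap R (FractionRing R))) := by
    rw [Matrix.map_rowExtension, ← Matrix.submatrix_map, map_patternMatrix,
      genericMatrix_eq_patternMatrix]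
    congr 3
    · ext1 a
      simp [R]
    · simp
  have hinj : Function.Injective (algebraMap R (FractionRing R)) := IsFractionRing.injective _ _
  have hdet : (((genericMatrix d).submatrix id f).rowExtension r).det =
      B₀.det.map (algebraMap R (FractionRing R)) := by
    rw [hB]
    exact (RingHom.map_det (mapRingHom (algebraMap R (FractionRing R))) B₀).symm
  rw [hdet, Ne, Polynomial.map_eq_zero_iff hinj, natDegree_map_eq_of_injective hinj]
  choose m hm using fun i => Option.ne_none_iff_exists'.1 (hf.2 i)
  let y : (Fin p × Fin v) × ℕ → ℝ := fun a => if a.1.2 = f a.1.1 then 1 else 0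
  let ψ : R →+* ℝ := MvPolynomial.eval y
  have hψ (a) : ψ (MvPolynomial.X a) = y a := MvPolynomial.eval_X a
  let g : Fin p → ℝ[X] := fun i => if i ∈ r then ∑ ℓ ∈ Finset.range (m i + 1), X ^ ℓ else 1
  have hmap : B₀.map (mapRingHom ψ) = Matrix.diagonal g := by
    rw [Matrix.map_rowExtension, ← Matrix.submatrix_map, map_patternMatrix]
    ext1 i j
    by_cases hi : i ∈ r
    · by_cases hij : i = j
      · subst hij
        simp [Matrix.rowExtension, hi, g, patternMatrix_of_eq_some (hm i), hψ, y]
      · have hfij : f j ≠ f i := fun h => hij (hf.1 h).symm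
        simp only [Matrix.rowExtension, if_pos hi, Matrix.submatrix_apply, id,
          Matrix.diagonal_apply_ne _ hij]
        cases hd : d (i, f j) with
        | none => exact patternMatrix_of_eq_none hd
        | some k => simp [patternMatrix_of_eq_some hd, hψ, y, hfij]
    · by_cases hij : i = j
      · subst hij
        simp [Matrix.rowExtension, hi, g]
      · simp [Matrix.rowExtension, hi, hij]
  have hprod : B₀.det.map ψ = ∏ i, g i := by
    rw [← Matrix.det_diagonal, ← hmap]
    exact RingHom.map_det (mapRingHom ψ) B₀
  have hcoeff (i : Fin p) (hi : i ∈ r) : (g i).coeff (m i) = 1 := by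
    simp [g, hi, finsetSum_coeff, coeff_X_pow]
  have hg (i : Fin p) : g i ≠ 0 := by
    by_cases hi : i ∈ r
    · intro h
      simpa [h] using hcoeff i hi
    · simp [g, hi]
  refine ⟨fun h => ?_, fun i hi k hk => ?_⟩
  · rw [h, Polynomial.map_zero] at hprod
    exact Finset.prod_ne_zero_iff.2 (fun i _ => hg i) hprod.symm
  · obtain rfl : m i = k := Option.some_injective _ ((hm i).symm.trans hk)
    calc m i ≤ (g i).natDegree := le_natDegree_of_ne_zero (by simp [hcoeff i hi])
      _ ≤ ∑ i, (g i).natDegree :=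
        Finset.single_le_sum (f := fun i => (g i).natDegree) (fun _ _ => Nat.zero_le _) (Finset.mem_univ i)
      _ = (B₀.det.map ψ).natDegree := by rw [hprod, natDegree_prod _ _ fun i _ => hg i]
      _ ≤ B₀.det.natDegree := natDegree_map_le

open Polynomial in
/-- If all edges meeting the rows of `r` have degree zero, the corresponding determinant is a
constant, hence a unit. -/
lemma isUnit_det_rowExtension_genericMatrix {p v : ℕ} {d : Fin p × Fin v → Option ℕ}
    {f : Fin p → Fin v} (hf : IsRSatMatching d f) {r : Finset (Fin p)}
    (hr : ∀ i ∈ r, ∀ j, d (i, j) ≠ none → d (i, j) = some 0) :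
    IsUnit (((genericMatrix d).submatrix id f).rowExtension r).det := by
  have hC (i j : Fin p) :
      ∃ a, ((genericMatrix d).submatrix id f).rowExtension r i j = C a := by
    by_cases hi : i ∈ r
    · cases hd : d (i, f j) with
      | none =>
        exact ⟨0, by
          simp [Matrix.rowExtension, hi, genericMatrix_eq_patternMatrix,
            patternMatrix_of_eq_none hd]⟩
      | some k =>
        have hd₀ := hr i hi (f j) (by simp [hd])
        exact ⟨_, by
          simp only [Matrix.rowExtension, hi, if_true, genericMatrix_eq_patternMatrix,
            Matrix.submatrix_apply, id, patternMatrix_of_eq_some hd₀, zero_add,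
            Finset.sum_range_one, pow_zero, mul_one]
          rfl⟩
    · exact ⟨(1 : Matrix _ _ _) i j, by
        simp [Matrix.rowExtension, hi, Matrix.one_apply, apply_ite C]⟩
  choose A hA using hC
  have hdet : (((genericMatrix d).submatrix id f).rowExtension r).det =
      C (Matrix.det (Matrix.of A)) := by
    rw [RingHom.map_det]
    congr 1
    ext1 i j
    exact hA i j
  have hne := (det_rowExtension_genericMatrix hf r).1
  rw [hdet] at hne ⊢
  exact isUnit_C.2 (isUnit_iff_ne_zero.2 fun h => hne (by rw [h, C_0]))

lemma exists_ringHom_field_of_ne_top.{u} {A : Type u} [CommRing A] {I : Ideal A} (hI : I ≠ ⊤) :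
    ∃ (L : Type u) (_ : Field L) (φ : A →+* L), ∀ a ∈ I, φ a = 0 := by
  obtain ⟨m, hm, hIm⟩ := I.exists_le_maximal hI
  exact ⟨A ⧸ m, Ideal.Quotient.field m, Ideal.Quotient.mk m, fun a ha =>
    Ideal.Quotient.eq_zero_iff_mem.2 (hIm ha)⟩

/-- The ideal generated by the maximal minors of a matrix. -/
def maximalMinorIdeal {p v : ℕ} {A : Type*} [CommRing A] (M : Matrix (Fin p) (Fin v) A) :
    Ideal A :=
  Ideal.span {q | ∃ c : Fin p → Fin v, Function.Injective c ∧ q = (M.submatrix id c).det}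

lemma det_submatrix_mem_maximalMinorIdeal {p v : ℕ} {A : Type*} [CommRing A]
    (M : Matrix (Fin p) (Fin v) A) {c : Fin p → Fin v} (hc : Function.Injective c) :
    (M.submatrix id c).det ∈ maximalMinorIdeal M :=
  Ideal.subset_span ⟨c, hc, rfl⟩

lemma maximalMinorIdeal_nonredundantPattern {p v : ℕ} (d : Fin p × Fin v → Option ℕ) :
    maximalMinorIdeal (genericMatrix (nonredundantPattern d)) =
      maximalMinorIdeal (genericMatrix d) := by
  unfold maximalMinorIdeal
  congr 1
  ext q
  refine exists_congr fun c => and_congr_right fun hc => ?_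
  rw [genericMatrix_eq_patternMatrix, genericMatrix_eq_patternMatrix,
    det_submatrix_nonredundantPattern d _ _ hc]

/-- The unit minor ideal forces property `P` when no edge is redundant. -/
lemma eq_some_zero_of_maximalMinorIdeal_eq_top {p v : ℕ} {d : Fin p × Fin v → Option ℕ}
    (hd : ∀ i j, d (i, j) ≠ none → ∃ f, IsRSatMatching d f ∧ f i = j)
    (htop : maximalMinorIdeal (genericMatrix d) = ⊤) {r : Finset (Fin p)} {c : Finset (Fin v)}
    (hrc : ∀ f, IsRSatMatching d f → r.image f = c) {f : Fin p → Fin v}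
    (hf : IsRSatMatching d f) {i : Fin p} (hi : i ∈ r) : d (i, f i) = some 0 := by
  set B := ((genericMatrix d).submatrix id f).rowExtension r with hB
  have hc : ∀ i ∈ r, ∀ j, d (i, j) ≠ none → ∃ i' ∈ r, f i' = j := by
    intro i hi j hij
    obtain ⟨g, hg, rfl⟩ := hd i j hij
    rw [← Finset.mem_image, hrc f hf, ← hrc g hg]
    exact Finset.mem_image_of_mem g hi
  obtain ⟨k, hk⟩ := Option.ne_none_iff_exists'.1 (hf.2 i)
  have hunit : IsUnit B.det := by
    by_contra hnu
    obtain ⟨L, _, φ, hφ⟩ := exists_ringHom_field_of_ne_top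
      (mt Ideal.span_singleton_eq_top.1 hnu)
    have hdet := hφ _ (Ideal.mem_span_singleton_self _)
    rw [hB, Matrix.map_det_rowExtension] at hdet
    obtain ⟨w, hw, hwM⟩ := Matrix.exists_vecMul_eq_zero_of_det_rowExtension_eq_zero hf.1
      (fun a ha j hj => by
        have : d (a, j) = none := by
          by_contra h
          exact hj (hc a ha j h)
        rw [Matrix.map_apply, genericMatrix_eq_patternMatrix, patternMatrix_of_eq_none this,
          map_zero]) hdet
    have hle : maximalMinorIdeal (genericMatrix d) ≤ RingHom.ker φ := by
      refine Ideal.span_le.2 ?_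
      rintro _ ⟨e, -, rfl⟩
      rw [SetLike.mem_coe, RingHom.mem_ker, Matrix.map_det_submatrix]
      exact Matrix.det_submatrix_eq_zero_of_vecMul_eq_zero hw hwM e
    exact RingHom.ker_ne_top φ (top_le_iff.1 (htop ▸ hle))
  have hdeg := (det_rowExtension_genericMatrix hf r).2 i hi k hk
  rw [← hB, Polynomial.natDegree_eq_zero_of_isUnit hunit, Nat.le_zero] at hdeg
  rw [hk, hdeg]

/-- Property `P` forces the unit minor ideal when no edge is redundant. -/
lemma maximalMinorIdeal_eq_top {p v : ℕ} {d : Fin p × Fin v → Option ℕ}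
    (hd : ∀ i j, d (i, j) ≠ none → ∃ f, IsRSatMatching d f ∧ f i = j)
    (hmatch : ∃ f, IsRSatMatching d f)
    (hP : ∀ (r : Finset (Fin p)) (c : Finset (Fin v)), r.card = c.card →
      (∀ f, IsRSatMatching d f → r.image f = c) →
      ∀ i ∈ r, ∀ j, (∃ f, IsRSatMatching d f ∧ f i = j) → d (i, j) = some 0) :
    maximalMinorIdeal (genericMatrix d) = ⊤ := by
  classical
  by_contra hne
  obtain ⟨L, _, φ, hφ⟩ := exists_ringHom_field_of_ne_top hne
  obtain ⟨w, hw, hwM⟩ := ((genericMatrix d).map φ).exists_vecMul_eq_zero_of_forall_det_eq_zero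
    fun e he => by
      rw [← Matrix.map_det_submatrix]
      exact hφ _ (det_submatrix_mem_maximalMinorIdeal _ he)
  obtain ⟨f, hf⟩ := hmatch
  let r : Finset (Fin p) := Finset.univ.filter (w · ≠ 0)
  let N : Finset (Fin v) := Finset.univ.filter fun j => ∃ i ∈ r, d (i, j) ≠ none
  have hNr : N.card ≤ r.card := by
    let R := MvPolynomial ((Fin p × Fin v) × ℕ) ℝ
    let ι : R →+* L := φ.comp (Polynomial.C.comp (algebraMap R (FractionRing R)))
    have hι : Function.Injective ι :=
      ((φ.comp Polynomial.C).injective).comp (IsFractionRing.injective R (FractionRing R))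
    let : Algebra ℝ L := (ι.comp MvPolynomial.C).toAlgebra
    let x : (Fin p × Fin v) × ℕ → L := fun a => ι (MvPolynomial.X a)
    have hx : AlgebraicIndependent ℝ x := by
      have : (MvPolynomial.aeval x : R →ₐ[ℝ] L).toRingHom = ι :=
        MvPolynomial.ringHom_ext (fun a => by simp; rfl) fun a => by simp [x]
      rw [AlgebraicIndependent]
      intro a b hab
      exact hι (this ▸ hab)
    rw [genericMatrix_eq_patternMatrix, map_patternMatrix] at hwM
    exact card_neighbors_le_card_support hx hw hwM r (by simp [r]) N (by simp [N])
  have himage (g : Fin p → Fin v) (hg : IsRSatMatching d g) : r.image g = N := by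
    refine Finset.eq_of_subset_of_card_le ?_ ?_
    · intro j hj
      obtain ⟨i, hi, rfl⟩ := Finset.mem_image.1 hj
      exact Finset.mem_filter.2 ⟨Finset.mem_univ _, i, hi, hg.2 i⟩
    · rwa [Finset.card_image_of_injective _ hg.1]
  have hcard : r.card = N.card := by
    rw [← himage f hf, Finset.card_image_of_injective _ hf.1]
  have hunit := isUnit_det_rowExtension_genericMatrix hf (r := r) fun i hi j hij =>
    hP r N hcard himage i hi j (hd i j hij)
  refine (hunit.map φ).ne_zero ?_
  rw [Matrix.map_det_rowExtension]
  exact Matrix.det_rowExtension_eq_zero_of_vecMul_eq_zero hw hwM f (by simp [r])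

/-- Theorem: assuming the pattern admits at least one `R`-saturating matching,
the `p × p` minors of the generic matrix generate the unit ideal of `K[s]`
(the zero set of `M` is generically empty) if and only if property `P` holds:
whenever `r ⊆ Fin p` and `c ⊆ Fin v` have equal cardinality and every
`R`-saturating matching maps `r` onto `c`, every non-redundant edge `(i, j)`
with `i ∈ r` has degree zero. -/
theorem genericMatrix_span_minors_eq_top_iff_propertyP {p v : ℕ} (hpv : p ≤ v)
    (d : Fin p × Fin v → Option ℕ)
    (hmatch : ∃ f : Fin p → Fin v, IsRSatMatching d f) :
    Ideal.span {q : Polynomial (FractionRing (MvPolynomial ((Fin p × Fin v) × ℕ) ℝ)) |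
        ∃ c : Fin p → Fin v, Function.Injective c ∧
          q = ((genericMatrix d).submatrix id c).det} = ⊤ ↔
      ∀ (r : Finset (Fin p)) (c : Finset (Fin v)), r.card = c.card →
        (∀ f : Fin p → Fin v, IsRSatMatching d f → r.image f = c) →
        ∀ i ∈ r, ∀ j : Fin v,
          (∃ f : Fin p → Fin v, IsRSatMatching d f ∧ f i = j) →
          d (i, j) = some 0 := by
  change maximalMinorIdeal (genericMatrix d) = ⊤ ↔ _
  rw [← maximalMinorIdeal_nonredundantPattern]
  have hd i j := exists_isRSatMatching_of_nonredundantPattern_ne_none (d := d) (i := i) (j := j)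
  have heq {i j} (h : ∃ f, IsRSatMatching d f ∧ f i = j) :
      nonredundantPattern d (i, j) = d (i, j) := if_pos h
  refine ⟨fun htop r c _ hrc i hi j => ?_, fun hP => maximalMinorIdeal_eq_top hd ?_ ?_⟩
  · rintro ⟨f, hf, rfl⟩
    rw [← heq ⟨f, hf, rfl⟩]
    simp_rw [← isRSatMatching_nonredundantPattern (d := d)] at hrc hf
    exact eq_some_zero_of_maximalMinorIdeal_eq_top hd htop hrc hf hi
  · simpa only [isRSatMatching_nonredundantPattern] using hmatch
  · simp_rw [isRSatMatching_nonredundantPattern]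
    intro r c hcard hrc i hi j hij
    rw [heq hij]
    exact hP r c hcard hrc i hi j hij
end

section
/- Let M be the generic p × v polynomial matrix (p ≤ v) associated to a degree pattern d with support S, and assume S admits at least one R-saturating matching. Consider the graph G_nr on the vertex set Fin p ⊕ Fin v in which a row vertex i and a column vertex j are adjacent exactly when (i,j) is a non-redundant edge of S. Then the p × p minors of M generate the unit ideal of K[s] if and only if for every connected component g of G_nr in which the number of row vertices equals the number of column vertices, every non-redundant edge (i,j) with both endpoints in g has d(i,j) = some 0. -/
/-- An edge `(i, j)` of the support of `d` is non-redundant when some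
`R`-saturating matching `f` has `f i = j`. -/
def NonRedundant {p v : ℕ} (d : Fin p × Fin v → Option ℕ) (i : Fin p) (j : Fin v) : Prop :=
  ∃ f : Fin p → Fin v, IsRSatMatching d f ∧ f i = j

/-- The bipartite graph `G_nr` on `Fin p ⊕ Fin v` in which a row vertex `i`
and a column vertex `j` are adjacent exactly when `(i, j)` is a non-redundant
edge of the support of `d`. -/
def Gnr {p v : ℕ} (d : Fin p × Fin v → Option ℕ) : SimpleGraph (Fin p ⊕ Fin v) :=
  SimpleGraph.fromRel fun a b =>
    ∃ i j, NonRedundant d i j ∧ a = Sum.inl i ∧ b = Sum.inr j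

/-- Over a unique factorization domain `R` with fraction field `K`, a polynomial over `K`
has a counterpart over `R` of the same degree dividing every polynomial over `R` that the original
one divides over `K`. -/
theorem exists_natDegree_eq_and_forall_dvd {R K : Type*} [CommRing R] [IsDomain R]
    [UniqueFactorizationMonoid R] [Field K] [Algebra R K] [IsFractionRing R K]
    (q : Polynomial K) :
    ∃ h : Polynomial R, h.natDegree = q.natDegree ∧
      ∀ m : Polynomial R, q ∣ m.map (algebraMap R K) → h ∣ m := by
  classical
  let _ : NormalizedGCDMonoid R := Classical.arbitrary _
  obtain ⟨b, hbmem, hb⟩ := IsLocalization.integerNormalization_spec (nonZeroDivisors R) q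
  set n := IsLocalization.integerNormalization (nonZeroDivisors R) q
  have hb0 : algebraMap R K b ≠ 0 :=
    IsFractionRing.to_map_ne_zero_of_mem_nonZeroDivisors hbmem
  have hmap : n.map (algebraMap R K) = Polynomial.C (algebraMap R K b) * q := by
    rw [hb, ← Polynomial.smul_eq_C_mul, algebraMap_smul]
  have hdeg : n.natDegree = q.natDegree := by
    rw [← Polynomial.natDegree_map_eq_of_injective (IsFractionRing.injective R K), hmap,
      Polynomial.natDegree_C_mul hb0]
  refine ⟨n.primPart, by rw [Polynomial.natDegree_primPart, hdeg], fun m hm => ?_⟩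
  refine n.isPrimitive_primPart.dvd_of_fraction_map_dvd_fraction_map (K := K) (dvd_trans ?_ hm)
  refine (Polynomial.map_dvd _ n.primPart_dvd).trans ?_
  rw [hmap]
  exact (Polynomial.isUnit_C.2 hb0.isUnit).mul_left_dvd.2 dvd_rfl

/-- A determinant lies in any subalgebra containing all the entries. -/
theorem Matrix.det_mem_subalgebra {n R A : Type*} [Fintype n] [DecidableEq n] [CommRing R]
    [CommRing A] [Algebra R A] (S : Subalgebra R A) (N : Matrix n n A) (h : ∀ i j, N i j ∈ S) :
    N.det ∈ S := by
  rw [Matrix.det_apply]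
  refine S.sum_mem fun τ _ => ?_
  rw [Units.smul_def]
  exact zsmul_mem (S.prod_mem fun i _ => h _ _) _

/-- A divisor of a nonzero polynomial involves no other variables. -/
theorem MvPolynomial.vars_subset_of_dvd {σ R : Type*} [CommRing R] [NoZeroDivisors R]
    {h m : MvPolynomial σ R} (hm : m ≠ 0) (hdvd : h ∣ m) : h.vars ⊆ m.vars := by
  obtain ⟨r, rfl⟩ := hdvd
  intro x hx
  rw [mem_vars_iff_degreeOf_ne_zero] at hx ⊢
  rw [degreeOf_mul_eq (left_ne_zero_of_mul hm) (right_ne_zero_of_mul hm)]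
  omega

/-- A column is avoidable when some `R`-saturating matching does not use it. -/
def Avoidable {p v : ℕ} (d : Fin p × Fin v → Option ℕ) (j : Fin v) : Prop :=
  ∃ f : Fin p → Fin v, IsRSatMatching d f ∧ ∀ i, f i ≠ j

section Matching

variable {p v : ℕ} {d : Fin p × Fin v → Option ℕ} {i : Fin p} {j j' : Fin v}

theorem NonRedundant.ne_none (h : NonRedundant d i j) : d (i, j) ≠ none := by
  obtain ⟨f, hf, rfl⟩ := h
  exact hf.2 i

theorem IsRSatMatching.nonRedundant {f : Fin p → Fin v} (hf : IsRSatMatching d f) (i : Fin p) :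
    NonRedundant d i (f i) :=
  ⟨f, hf, rfl⟩

/-- Two matchings can be glued along a set `B` of rows. -/
theorem IsRSatMatching.piecewise {f f' : Fin p → Fin v} (hf : IsRSatMatching d f)
    (hf' : IsRSatMatching d f') (B : Set (Fin p)) [DecidablePred (· ∈ B)]
    (hB : ∀ r ∈ B, ∀ r' ∉ B, f r ≠ f' r') : IsRSatMatching d (B.piecewise f f') := by
  refine ⟨fun a b hab => ?_, fun r => ?_⟩
  · by_cases ha : a ∈ B <;> by_cases hb : b ∈ B <;> simp [Set.piecewise, ha, hb] at hab
    · exact hf.1 hab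
    · exact (hB a ha b hb hab).elim
    · exact (hB b hb a ha hab.symm).elim
    · exact hf'.1 hab
  · by_cases hr : r ∈ B <;> simp only [Set.piecewise, hr, if_true, if_false]
    · exact hf.2 r
    · exact hf'.2 r

theorem IsRSatMatching.update {f : Fin p → Fin v} (hf : IsRSatMatching d f)
    (hj : ∀ r, f r ≠ j) (hij : d (i, j) ≠ none) : IsRSatMatching d (Function.update f i j) := by
  refine ⟨fun a b hab => ?_, fun r => ?_⟩
  · by_cases ha : a = i <;> by_cases hb : b = i <;>
      simp only [Function.update_apply, ha, hb, if_true, if_false] at hab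
    · rw [ha, hb]
    · exact (hj b hab.symm).elim
    · exact (hj a hab).elim
    · exact hf.1 hab
  · by_cases hr : r = i
    · subst hr; simpa using hij
    · simpa [hr] using hf.2 r

/-- If the row `i` is joined to an avoidable column, then every non-redundant edge at `i`
leads to an avoidable column. -/
theorem Avoidable.of_nonRedundant (hj' : Avoidable d j') (hij' : d (i, j') ≠ none)
    (hij : NonRedundant d i j) : Avoidable d j := by
  classical
  obtain ⟨f', hf', havoid⟩ := hj'
  obtain ⟨f, hf, rfl⟩ := hij
  let B : Set (Fin p) := {r | Relation.ReflTransGen (fun r r' => f r' = f' r) i r}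
  have hiB : i ∈ B := Relation.ReflTransGen.refl
  have hclosed : ∀ r ∈ B, ∀ r', f r' = f' r → r' ∈ B := fun r hr r' h => hr.tail h
  by_cases hcyc : ∃ r ∈ B, f' r = f i
  · have hpre : ∀ b ∈ B, ∃ r ∈ B, f' r = f b := by
      intro b hb
      rcases Relation.ReflTransGen.cases_tail hb with rfl | ⟨c, hc, hcb⟩
      · exact hcyc
      · exact ⟨c, hc, hcb.symm⟩
    have hg : IsRSatMatching d (B.piecewise f f') := by
      refine hf.piecewise hf' B fun b hb r hr h => ?_
      obtain ⟨r', hr', h'⟩ := hpre b hb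
      exact hr (hf'.1 (h'.trans h) ▸ hr')
    have hgj' : ∀ r, B.piecewise f f' r ≠ j' := by
      intro r
      by_cases hr : r ∈ B <;> simp only [Set.piecewise, hr, if_true, if_false]
      · obtain ⟨r', -, h'⟩ := hpre r hr
        exact h' ▸ havoid r'
      · exact havoid r
    have hgi : B.piecewise f f' i = f i := by simp [Set.piecewise, hiB]
    refine ⟨_, hg.update hgj' hij', fun r => ?_⟩
    by_cases hr : r = i
    · subst hr
      simpa [hgi] using (hgj' r).symm
    · rw [Function.update_of_ne hr, ← hgi]
      exact fun h => hr (hg.1 h)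
  · push Not at hcyc
    refine ⟨_, hf'.piecewise hf B fun b hb r hr h => hr (hclosed b hb r h.symm), fun r => ?_⟩
    by_cases hr : r ∈ B <;> simp only [Set.piecewise, hr, if_true, if_false]
    · exact hcyc r hr
    · exact fun h => hr (hf.1 h ▸ hiB)

theorem Gnr_adj_inl_inr : (Gnr d).Adj (Sum.inl i) (Sum.inr j) ↔ NonRedundant d i j := by
  simp [Gnr]

theorem NonRedundant.connectedComponentMk_eq (h : NonRedundant d i j) :
    (Gnr d).connectedComponentMk (Sum.inl i) = (Gnr d).connectedComponentMk (Sum.inr j) :=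
  SimpleGraph.ConnectedComponent.sound (Gnr_adj_inl_inr.2 h).reachable

/-- Avoidability is constant along the connected components of `Gnr d`. -/
theorem Avoidable.of_reachable (hj' : Avoidable d j')
    (h : (Gnr d).Reachable (Sum.inr j') (Sum.inr j)) : Avoidable d j := by
  let P : Fin p ⊕ Fin v → Prop :=
    Sum.elim (fun i => ∀ j, NonRedundant d i j → Avoidable d j) (Avoidable d)
  have hstep : ∀ a b, (Gnr d).Adj a b → P a → P b := by
    rintro (a | a) (b | b) hab ha
    · simp [Gnr] at hab
    · exact ha b (Gnr_adj_inl_inr.1 hab)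
    · exact fun k hk => ha.of_nonRedundant (Gnr_adj_inl_inr.1 hab.symm).ne_none hk
    · simp [Gnr] at hab
  obtain ⟨w⟩ := h
  have hwalk : ∀ a b, (Gnr d).Walk a b → P a → P b := by
    intro a b w
    induction w with
    | nil => exact id
    | cons hab _ ih => exact fun ha => ih (hstep _ _ hab ha)
  exact hwalk _ _ w hj'

/-- The map induced by a matching from the rows to the columns of a connected component. -/
def IsRSatMatching.componentMap {f : Fin p → Fin v} (hf : IsRSatMatching d f)
    (g : (Gnr d).ConnectedComponent)
    (r : {i : Fin p // (Gnr d).connectedComponentMk (Sum.inl i) = g}) :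
    {j : Fin v // (Gnr d).connectedComponentMk (Sum.inr j) = g} :=
  ⟨f r, (hf.nonRedundant r).connectedComponentMk_eq.symm.trans r.2⟩

theorem IsRSatMatching.componentMap_injective {f : Fin p → Fin v} (hf : IsRSatMatching d f)
    (g : (Gnr d).ConnectedComponent) : Function.Injective (hf.componentMap g) :=
  fun _ _ h => Subtype.ext (hf.1 (congrArg Subtype.val h))

/-- A component containing an unavoidable column has as many rows as columns. -/
theorem card_rows_eq_card_columns_of_not_avoidable (hmatch : ∃ f, IsRSatMatching d f)
    (hj : ¬ Avoidable d j) :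
    Nat.card {i : Fin p // (Gnr d).connectedComponentMk (Sum.inl i) =
        (Gnr d).connectedComponentMk (Sum.inr j)} =
      Nat.card {j' : Fin v // (Gnr d).connectedComponentMk (Sum.inr j') =
        (Gnr d).connectedComponentMk (Sum.inr j)} := by
  obtain ⟨f, hf⟩ := hmatch
  refine Nat.card_congr (Equiv.ofBijective (hf.componentMap _)
    ⟨hf.componentMap_injective _, ?_⟩)
  by_contra hsurj
  simp only [Function.Surjective, not_forall, not_exists] at hsurj
  obtain ⟨⟨j', hj'⟩, hne⟩ := hsurj
  refine hj (Avoidable.of_reachable (j' := j') ⟨f, hf, fun r hr => ?_⟩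
    (SimpleGraph.ConnectedComponent.exact hj'))
  exact hne ⟨r, by rw [(hf.nonRedundant r).connectedComponentMk_eq, hr, hj']⟩ (Subtype.ext hr)

end Matching

section Generic

open MvPolynomial

variable {p v : ℕ}

/-- The non-redundant part of the generic matrix, with entries in the polynomial ring over `ℝ` in
all the coefficients together with the variable `s`, which is `X none`. -/
noncomputable def nonRedundantMatrix (d : Fin p × Fin v → Option ℕ) :
    Matrix (Fin p) (Fin v) (MvPolynomial (Option ((Fin p × Fin v) × ℕ)) ℝ) :=
  open Classical in fun i j =>
    if NonRedundant d i j then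
      ∑ ℓ ∈ Finset.range ((d (i, j)).getD 0 + 1), X (some ((i, j), ℓ)) * X none ^ ℓ
    else 0

/-- The embedding of the polynomial ring in the coefficients and `s` into `K[s]`. -/
noncomputable def toPolynomialFractionRing (σ : Type*) :
    MvPolynomial (Option σ) ℝ →+* Polynomial (FractionRing (MvPolynomial σ ℝ)) :=
  (Polynomial.mapRingHom (algebraMap _ _)).comp (optionEquivLeft ℝ σ).toRingEquiv.toRingHom

/-- Substitution of real values for the coefficients. -/
noncomputable def evalCoeffs {σ : Type*} (a : σ → ℝ) :
    MvPolynomial (Option σ) ℝ →+* Polynomial ℝ :=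
  (Polynomial.mapRingHom (eval a)).comp (optionEquivLeft ℝ σ).toRingEquiv.toRingHom

theorem toPolynomialFractionRing_apply {σ : Type*} (q : MvPolynomial (Option σ) ℝ) :
    toPolynomialFractionRing σ q = (optionEquivLeft ℝ σ q).map (algebraMap _ _) := rfl

theorem toPolynomialFractionRing_injective (σ : Type*) :
    Function.Injective (toPolynomialFractionRing σ) :=
  (Polynomial.map_injective _ (IsFractionRing.injective _ _)).comp
    (optionEquivLeft ℝ σ).injective

theorem natDegree_toPolynomialFractionRing {σ : Type*} (q : MvPolynomial (Option σ) ℝ) :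
    (toPolynomialFractionRing σ q).natDegree = (optionEquivLeft ℝ σ q).natDegree := by
  rw [toPolynomialFractionRing_apply,
    Polynomial.natDegree_map_eq_of_injective (IsFractionRing.injective _ _)]

theorem natDegree_evalCoeffs_le {σ : Type*} (a : σ → ℝ) (q : MvPolynomial (Option σ) ℝ) :
    (evalCoeffs a q).natDegree ≤ (optionEquivLeft ℝ σ q).natDegree :=
  Polynomial.natDegree_map_le

@[simp] theorem evalCoeffs_X_none {σ : Type*} (a : σ → ℝ) :
    evalCoeffs a (X none) = Polynomial.X := by
  simp [evalCoeffs]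

@[simp] theorem evalCoeffs_X_some {σ : Type*} (a : σ → ℝ) (x : σ) :
    evalCoeffs a (X (some x)) = Polynomial.C (a x) := by
  simp [evalCoeffs]

@[simp] theorem evalCoeffs_C {σ : Type*} (a : σ → ℝ) (x : ℝ) :
    evalCoeffs a (C x) = Polynomial.C x := by
  simp [evalCoeffs]

variable {d : Fin p × Fin v → Option ℕ}

theorem toPolynomialFractionRing_nonRedundantMatrix {i : Fin p} {j : Fin v}
    (h : NonRedundant d i j) :
    toPolynomialFractionRing _ (nonRedundantMatrix d i j) = genericMatrix d i j := by
  obtain ⟨k, hk⟩ := Option.ne_none_iff_exists'.1 h.ne_none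
  simp [nonRedundantMatrix, genericMatrix, h, hk, toPolynomialFractionRing]

/-- Redundant entries contribute to no maximal minor. -/
theorem det_submatrix_genericMatrix {c : Fin p → Fin v} (hc : Function.Injective c) :
    ((genericMatrix d).submatrix id c).det =
      toPolynomialFractionRing _ ((nonRedundantMatrix d).submatrix id c).det := by
  rw [RingHom.map_det, Matrix.det_apply, Matrix.det_apply]
  refine Finset.sum_congr rfl fun τ _ => congrArg _ ?_
  by_cases h : ∀ i, d (τ i, c i) ≠ none
  · have hf : IsRSatMatching d (c ∘ τ.symm) :=
      ⟨hc.comp τ.symm.injective, fun i => by simpa using h (τ.symm i)⟩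
    refine Finset.prod_congr rfl fun i _ => ?_
    have hn : NonRedundant d (τ i) (c i) := by simpa using hf.nonRedundant (τ i)
    exact (toPolynomialFractionRing_nonRedundantMatrix hn).symm
  · push Not at h
    obtain ⟨i, hi⟩ := h
    rw [Finset.prod_eq_zero (Finset.mem_univ i), Finset.prod_eq_zero (Finset.mem_univ i)]
    · have hn : ¬ NonRedundant d (τ i) (c i) := fun hn => hn.ne_none hi
      simp [nonRedundantMatrix, hn]
    · simp [genericMatrix, hi]

theorem evalCoeffs_nonRedundantMatrix {i : Fin p} {j : Fin v} (h : NonRedundant d i j)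
    (a : (Fin p × Fin v) × ℕ → ℝ) :
    evalCoeffs a (nonRedundantMatrix d i j) =
      ∑ ℓ ∈ Finset.range ((d (i, j)).getD 0 + 1),
        Polynomial.C (a ((i, j), ℓ)) * Polynomial.X ^ ℓ := by
  simp [nonRedundantMatrix, h]

theorem nonRedundantMatrix_mem_supported (i : Fin p) (j : Fin v) :
    nonRedundantMatrix d i j ∈
      supported ℝ ({none} ∪ {x | ∃ ℓ, x = some ((i, j), ℓ)}) := by
  unfold nonRedundantMatrix
  split_ifs
  · exact sum_mem fun ℓ _ => mul_mem (X_mem_supported.2 (by simp))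
      (pow_mem (X_mem_supported.2 (by simp)) _)
  · exact zero_mem _

/-- The coefficients that turn the generic matrix into the indicator matrix of `f`. -/
def indicatorCoeffs (f : Fin p → Fin v) (x : (Fin p × Fin v) × ℕ) : ℝ :=
  if x.1.2 = f x.1.1 ∧ x.2 = 0 then 1 else 0

theorem evalCoeffs_det_submatrix {f : Fin p → Fin v} (hf : IsRSatMatching d f) :
    evalCoeffs (indicatorCoeffs f) ((nonRedundantMatrix d).submatrix id f).det = 1 := by
  rw [RingHom.map_det]
  convert Matrix.det_one (n := Fin p) (R := Polynomial ℝ)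
  ext1 r c
  by_cases hn : NonRedundant d r (f c)
  · simp only [RingHom.mapMatrix_apply, Matrix.map_apply, Matrix.submatrix_apply, id,
      evalCoeffs_nonRedundantMatrix hn, Matrix.one_apply]
    by_cases h : r = c
    · subst h
      simp [indicatorCoeffs]
    · have h' : f c ≠ f r := fun e => h (hf.1 e).symm
      simp [indicatorCoeffs, h, h']
  · have h : r ≠ c := by
      rintro rfl
      exact hn (hf.nonRedundant r)
    simp [nonRedundantMatrix, hn, h]

open Classical in
/-- Specialization of the coefficients of the avoidable columns to the indicator of `f`. -/
noncomputable def specializeAvoidable (d : Fin p × Fin v → Option ℕ) (f : Fin p → Fin v) :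
    MvPolynomial (Option ((Fin p × Fin v) × ℕ)) ℝ →ₐ[ℝ]
      MvPolynomial (Option ((Fin p × Fin v) × ℕ)) ℝ :=
  aeval fun x => x.elim (X none) fun y =>
    if Avoidable d y.1.2 then C (indicatorCoeffs f y) else X (some y)

theorem evalCoeffs_specializeAvoidable (f : Fin p → Fin v)
    (q : MvPolynomial (Option ((Fin p × Fin v) × ℕ)) ℝ) :
    evalCoeffs (indicatorCoeffs f) (specializeAvoidable d f q) =
      evalCoeffs (indicatorCoeffs f) q := by
  suffices h : (evalCoeffs (indicatorCoeffs f)).comp (specializeAvoidable d f).toRingHom =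
      evalCoeffs (indicatorCoeffs f) from congrArg (fun φ => φ q) h
  refine MvPolynomial.ringHom_ext (fun r => by simp [specializeAvoidable]) ?_
  rintro (_ | y)
  · simp [specializeAvoidable]
  · by_cases hy : Avoidable d y.1.2 <;> simp [specializeAvoidable, hy]

/-- A common divisor of all the maximal minors has no coefficient variable from an avoidable
column. -/
theorem not_avoidable_of_mem_vars {h : MvPolynomial (Option ((Fin p × Fin v) × ℕ)) ℝ}
    (hdvd : ∀ c : Fin p → Fin v, Function.Injective c →
      h ∣ ((nonRedundantMatrix d).submatrix id c).det)
    {y : (Fin p × Fin v) × ℕ} (hy : some y ∈ h.vars) : ¬ Avoidable d y.1.2 := by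
  rintro ⟨f, hf, havoid⟩
  have hne : ((nonRedundantMatrix d).submatrix id f).det ≠ 0 := fun h0 => by
    simpa [h0] using evalCoeffs_det_submatrix hf
  have hmem : ((nonRedundantMatrix d).submatrix id f).det ∈
      supported ℝ {x : Option ((Fin p × Fin v) × ℕ) | x ≠ some y} := by
    refine Matrix.det_mem_subalgebra _ _ fun r c => ?_
    refine supported_mono ?_ (nonRedundantMatrix_mem_supported r (f c))
    rintro x (rfl | ⟨ℓ, rfl⟩)
    · simp
    · rintro ⟨⟩
      exact havoid c rfl
  exact mem_supported.1 hmem (vars_subset_of_dvd hne (hdvd f hf.1) hy) rfl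

/-- If all the non-redundant entries in unavoidable columns have degree zero, then a common divisor
of the maximal minors does not involve `s`. -/
theorem natDegree_eq_zero_of_forall_dvd (hmatch : ∃ f, IsRSatMatching d f)
    (hd : ∀ i j, NonRedundant d i j → ¬ Avoidable d j → d (i, j) = some 0)
    {h : MvPolynomial (Option ((Fin p × Fin v) × ℕ)) ℝ}
    (hdvd : ∀ c : Fin p → Fin v, Function.Injective c →
      h ∣ ((nonRedundantMatrix d).submatrix id c).det) :
    (optionEquivLeft ℝ _ h).natDegree = 0 := by
  obtain ⟨f, hf⟩ := hmatch
  set χ := specializeAvoidable d f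
  have hχ : χ h = h := by
    refine hom_congr_vars (f₁ := χ.toRingHom) (f₂ := RingHom.id _) ?_ ?_ rfl
    · ext; simp
    · rintro (_ | y) hy -
      · simp [χ, specializeAvoidable]
      · simp [χ, specializeAvoidable, not_avoidable_of_mem_vars hdvd hy]
  set D := ((nonRedundantMatrix d).submatrix id f).det
  have hne : χ D ≠ 0 := fun h0 => by
    have := evalCoeffs_det_submatrix hf
    rw [← evalCoeffs_specializeAvoidable (d := d)] at this
    simp [χ, D] at h0
    simp [h0] at this
  have hmem : χ D ∈ supported ℝ {x : Option ((Fin p × Fin v) × ℕ) | x ≠ none} := by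
    rw [AlgHom.map_det]
    refine Matrix.det_mem_subalgebra _ _ fun r c => ?_
    simp only [AlgHom.mapMatrix_apply, Matrix.map_apply, Matrix.submatrix_apply, id]
    by_cases hn : NonRedundant d r (f c)
    · by_cases ha : Avoidable d (f c)
      · have : χ (nonRedundantMatrix d r (f c)) = C (if r = c then 1 else 0) := by
          by_cases hrc : r = c
          · subst hrc
            simp [χ, specializeAvoidable, nonRedundantMatrix, hn, ha, indicatorCoeffs,
              Finset.sum_range_succ']
          · have h' : f c ≠ f r := fun e => hrc (hf.1 e).symm
            simp [χ, specializeAvoidable, nonRedundantMatrix, hn, ha, indicatorCoeffs, hrc, h']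
        rw [this]
        exact Subalgebra.algebraMap_mem _ _
      · have : χ (nonRedundantMatrix d r (f c)) = X (some ((r, f c), 0)) := by
          simp [χ, specializeAvoidable, nonRedundantMatrix, hn, ha, hd _ _ hn ha]
        rw [this]
        exact X_mem_supported.2 (by simp)
    · simp [nonRedundantMatrix, hn, zero_mem]
  rw [natDegree_optionEquivLeft]
  by_contra hdeg
  have hdvd' : h ∣ χ D := hχ ▸ map_dvd χ (hdvd f hf.1)
  exact mem_supported.1 hmem
    (vars_subset_of_dvd hne hdvd' (mem_vars_iff_degreeOf_ne_zero.2 hdeg)) rfl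

open Classical in
/-- The square block of the component `g` selected by the matching `f`, completed by an identity
block on the remaining rows. -/
noncomputable def componentBlock (d : Fin p × Fin v → Option ℕ) (f : Fin p → Fin v)
    (g : (Gnr d).ConnectedComponent) :
    Matrix (Fin p) (Fin p) (MvPolynomial (Option ((Fin p × Fin v) × ℕ)) ℝ) := fun r c =>
  if (Gnr d).connectedComponentMk (Sum.inl c) = g then nonRedundantMatrix d r (f c)
  else (1 : Matrix (Fin p) (Fin p) _) r c

/-- The determinant of the block of a component has degree at least that of any of the entries
selected by the matching. -/
theorem le_natDegree_det_componentBlock {f : Fin p → Fin v} (hf : IsRSatMatching d f) {i : Fin p}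
    {k : ℕ} (hk : d (i, f i) = some k) :
    k ≤ (optionEquivLeft ℝ _ (componentBlock d f
      ((Gnr d).connectedComponentMk (Sum.inl i))).det).natDegree := by
  rcases Nat.eq_zero_or_pos k with rfl | hkpos
  · exact Nat.zero_le _
  let a : (Fin p × Fin v) × ℕ → ℝ := fun x =>
    indicatorCoeffs f x + if x = ((i, f i), k) then 1 else 0
  have hdet : evalCoeffs a (componentBlock d f ((Gnr d).connectedComponentMk (Sum.inl i))).det =
      1 + Polynomial.X ^ k := by
    have hdiag : (evalCoeffs a).mapMatrix
        (componentBlock d f ((Gnr d).connectedComponentMk (Sum.inl i))) =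
        Matrix.diagonal fun r => if r = i then 1 + Polynomial.X ^ k else 1 := by
      ext1 r c
      simp only [RingHom.mapMatrix_apply, Matrix.map_apply, componentBlock]
      split_ifs with hc
      · by_cases hn : NonRedundant d r (f c)
        · rw [evalCoeffs_nonRedundantMatrix hn]
          by_cases hrc : r = c
          · subst hrc
            by_cases hri : r = i
            · subst hri
              simp [a, indicatorCoeffs, hk, add_mul, Finset.sum_add_distrib]
            · simp [a, indicatorCoeffs, hri]
          · have h' : f c ≠ f r := fun e => hrc (hf.1 e).symm
            have h'' : ¬ (r = i ∧ f c = f i) := by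
              rintro ⟨rfl, e⟩
              exact h' e
            simp [a, indicatorCoeffs, hrc, h', h'']
        · have hrc : r ≠ c := by
            rintro rfl
            exact hn (hf.nonRedundant r)
          simp [nonRedundantMatrix, hn, hrc]
      · have hci : c ≠ i := by
          rintro rfl
          exact hc rfl
        by_cases hrc : r = c
        · subst hrc
          simp [hci]
        · simp [hrc]
    rw [RingHom.map_det, hdiag, Matrix.det_diagonal]
    simp
  refine le_trans (le_of_eq ?_) (natDegree_evalCoeffs_le a _)
  rw [hdet, add_comm, ← Polynomial.C_1, Polynomial.natDegree_X_pow_add_C]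

/-- A ring homomorphism to a domain killing the determinant of the block of a component with as many
rows as columns kills all the maximal minors. -/
theorem map_det_submatrix_eq_zero {L : Type*} [CommRing L] [IsDomain L]
    (φ : MvPolynomial (Option ((Fin p × Fin v) × ℕ)) ℝ →+* L)
    {f : Fin p → Fin v} (hf : IsRSatMatching d f) (g : (Gnr d).ConnectedComponent)
    (hcard : Nat.card {i : Fin p // (Gnr d).connectedComponentMk (Sum.inl i) = g} =
      Nat.card {j : Fin v // (Gnr d).connectedComponentMk (Sum.inr j) = g})
    (hφ : φ (componentBlock d f g).det = 0) (c : Fin p → Fin v) :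
    φ ((nonRedundantMatrix d).submatrix id c).det = 0 := by
  rw [RingHom.map_det] at hφ ⊢
  obtain ⟨w, hw0, hw⟩ := Matrix.exists_vecMul_eq_zero_iff.2 hφ
  refine Matrix.exists_vecMul_eq_zero_iff.1 ⟨w, hw0, ?_⟩
  have hout : ∀ r, (Gnr d).connectedComponentMk (Sum.inl r) ≠ g → w r = 0 := by
    intro r hr
    simpa [Matrix.vecMul, dotProduct, componentBlock, hr, Matrix.one_apply, apply_ite φ] using
      congrFun hw r
  funext x
  change ∑ r, w r * φ (nonRedundantMatrix d r (c x)) = 0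
  by_cases hx : (Gnr d).connectedComponentMk (Sum.inr (c x)) = g
  · obtain ⟨⟨r, hr⟩, hrx⟩ :=
      ((Nat.bijective_iff_injective_and_card _).2
        ⟨hf.componentMap_injective g, hcard⟩).surjective ⟨c x, hx⟩
    have hfr : f r = c x := congrArg Subtype.val hrx
    simpa [Matrix.vecMul, dotProduct, componentBlock, hr, hfr] using congrFun hw r
  · refine Finset.sum_eq_zero fun r _ => ?_
    by_cases hr : (Gnr d).connectedComponentMk (Sum.inl r) = g
    · have hn : ¬ NonRedundant d r (c x) := fun hn =>
        hx (hn.connectedComponentMk_eq.symm.trans hr)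
      simp [nonRedundantMatrix, hn]
    · simp [hout r hr]

end Generic

/-- Theorem: assuming the pattern admits at least one `R`-saturating matching,
the `p × p` minors of the generic matrix generate the unit ideal of `K[s]`
if and only if for every connected component of `G_nr` having as many row
vertices as column vertices, every non-redundant edge inside that component
has degree zero. -/
theorem genericMatrix_span_minors_eq_top_iff_components {p v : ℕ} (hpv : p ≤ v)
    (d : Fin p × Fin v → Option ℕ)
    (hmatch : ∃ f : Fin p → Fin v, IsRSatMatching d f) :
    Ideal.span {q : Polynomial (FractionRing (MvPolynomial ((Fin p × Fin v) × ℕ) ℝ)) |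
        ∃ c : Fin p → Fin v, Function.Injective c ∧
          q = ((genericMatrix d).submatrix id c).det} = ⊤ ↔
      ∀ g : (Gnr d).ConnectedComponent,
        Nat.card {i : Fin p // (Gnr d).connectedComponentMk (Sum.inl i) = g} =
          Nat.card {j : Fin v // (Gnr d).connectedComponentMk (Sum.inr j) = g} →
        ∀ (i : Fin p) (j : Fin v), NonRedundant d i j →
          (Gnr d).connectedComponentMk (Sum.inl i) = g →
          d (i, j) = some 0 := by
  classical
  constructor
  · intro htop g hcard i j hij hg
    obtain ⟨f, hf, rfl⟩ := hij
    obtain ⟨k, hk⟩ := Option.ne_none_iff_exists'.1 (hf.2 i)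
    rcases Nat.eq_zero_or_pos k with rfl | hkpos
    · exact hk
    exfalso
    subst hg
    set D := toPolynomialFractionRing _
      (componentBlock d f ((Gnr d).connectedComponentMk (Sum.inl i))).det
    have hD : 0 < D.natDegree := by
      rw [natDegree_toPolynomialFractionRing]
      exact hkpos.trans_le (le_natDegree_det_componentBlock hf hk)
    obtain ⟨P, hP, hDP⟩ := Ideal.exists_le_maximal (Ideal.span {D})
      (mt Ideal.span_singleton_eq_top.1
        fun hu => hD.ne' (Polynomial.natDegree_eq_zero_of_isUnit hu))
    have hDmem : D ∈ P := hDP (Ideal.mem_span_singleton_self D)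
    refine hP.ne_top (top_le_iff.1 (htop ▸ Ideal.span_le.2 ?_))
    rintro _ ⟨c, hc, rfl⟩
    have hprime := hP.isPrime
    let φ := (Ideal.Quotient.mk P).comp (toPolynomialFractionRing ((Fin p × Fin v) × ℕ))
    have hφD : φ (componentBlock d f ((Gnr d).connectedComponentMk (Sum.inl i))).det = 0 :=
      Ideal.Quotient.eq_zero_iff_mem.2 hDmem
    have hφ := map_det_submatrix_eq_zero (L := _ ⧸ P) φ hf _ hcard hφD c
    rw [det_submatrix_genericMatrix hc]
    exact Ideal.Quotient.eq_zero_iff_mem.1 hφ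
  · intro hcomp
    set I := Ideal.span {q : Polynomial (FractionRing (MvPolynomial ((Fin p × Fin v) × ℕ) ℝ)) |
        ∃ c : Fin p → Fin v, Function.Injective c ∧
          q = ((genericMatrix d).submatrix id c).det}
    obtain ⟨q, hq⟩ := (IsPrincipalIdealRing.principal I).principal
    change I = Ideal.span {q} at hq
    have hqdvd : ∀ c : Fin p → Fin v, Function.Injective c →
        q ∣ toPolynomialFractionRing _ ((nonRedundantMatrix d).submatrix id c).det := by
      intro c hc
      rw [← det_submatrix_genericMatrix hc, ← Ideal.mem_span_singleton, ← hq]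
      exact Ideal.subset_span ⟨c, hc, rfl⟩
    obtain ⟨f, hf⟩ := hmatch
    have hq0 : q ≠ 0 := by
      rintro rfl
      have h0 := zero_dvd_iff.1 (hqdvd f hf.1)
      rw [map_eq_zero_iff _ (toPolynomialFractionRing_injective _)] at h0
      simpa [h0] using evalCoeffs_det_submatrix hf
    obtain ⟨h, hdeg, hdvd⟩ := exists_natDegree_eq_and_forall_dvd
      (R := MvPolynomial ((Fin p × Fin v) × ℕ) ℝ) q
    have hzero := natDegree_eq_zero_of_forall_dvd (d := d)
      (h := (MvPolynomial.optionEquivLeft ℝ _).symm h) ⟨f, hf⟩ (fun i j hij hj =>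
        hcomp _ (card_rows_eq_card_columns_of_not_avoidable ⟨f, hf⟩ hj) i j hij
          hij.connectedComponentMk_eq)
      (fun c hc => by
        have hc' := map_dvd (MvPolynomial.optionEquivLeft ℝ ((Fin p × Fin v) × ℕ)).symm
          (hdvd (MvPolynomial.optionEquivLeft ℝ _ ((nonRedundantMatrix d).submatrix id c).det)
            (hqdvd c hc))
        rwa [AlgEquiv.symm_apply_apply] at hc')
    rw [AlgEquiv.apply_symm_apply, hdeg] at hzero
    rw [hq, Ideal.span_singleton_eq_top, Polynomial.isUnit_iff_degree_eq_zero,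
      Polynomial.degree_eq_natDegree hq0, hzero, Nat.cast_zero]
end

section
/- Let p₁, q₁, p₂, q₂ be the generic real polynomials of degrees n₁, m₁, n₂, m₂ respectively (coefficients independent indeterminates, with K the fraction field of the coefficient ring), and let M_ser ∈ K[s]^{2×3} be the matrix with rows (q₁, −p₁, 0) and (0, q₂, −p₂) describing the series interconnection of two SISO systems with transfer functions q₁/p₁ and q₂/p₂. Then (a) every position (i,j) with nonzero entry of M_ser belongs to some R-saturating matching of the support of M_ser (no edge of the associated bipartite graph is redundant), and (b) the 2 × 2 minors of M_ser generate the unit ideal of K[s], i.e., the series interconnection is structurally controllable. -/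
/-- The coefficient field `K`: the field of fractions of the multivariate
polynomial ring over `ℝ` whose indeterminates are the coefficients of the four
generic polynomials `p₁` (degree `n₁`), `q₁` (degree `m₁`), `p₂` (degree `n₂`),
`q₂` (degree `m₂`). -/
abbrev Kc (n₁ m₁ n₂ m₂ : ℕ) :=
  FractionRing
    (MvPolynomial (Fin (n₁ + 1) ⊕ Fin (m₁ + 1) ⊕ Fin (n₂ + 1) ⊕ Fin (m₂ + 1)) ℝ)

/-- The image in `K` of the coefficient indeterminate indexed by `x`. -/
noncomputable def coeffVar (n₁ m₁ n₂ m₂ : ℕ)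
    (x : Fin (n₁ + 1) ⊕ Fin (m₁ + 1) ⊕ Fin (n₂ + 1) ⊕ Fin (m₂ + 1)) :
    Kc n₁ m₁ n₂ m₂ :=
  algebraMap
    (MvPolynomial (Fin (n₁ + 1) ⊕ Fin (m₁ + 1) ⊕ Fin (n₂ + 1) ⊕ Fin (m₂ + 1)) ℝ)
    (Kc n₁ m₁ n₂ m₂) (MvPolynomial.X x)

/-- The generic polynomial `p₁ = ∑_{ℓ ≤ n₁} a_ℓ s^ℓ`. -/
noncomputable def P1 (n₁ m₁ n₂ m₂ : ℕ) : Polynomial (Kc n₁ m₁ n₂ m₂) :=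
  ∑ ℓ : Fin (n₁ + 1),
    Polynomial.C (coeffVar n₁ m₁ n₂ m₂ (Sum.inl ℓ)) * Polynomial.X ^ (ℓ : ℕ)

/-- The generic polynomial `q₁ = ∑_{ℓ ≤ m₁} b_ℓ s^ℓ`. -/
noncomputable def Q1 (n₁ m₁ n₂ m₂ : ℕ) : Polynomial (Kc n₁ m₁ n₂ m₂) :=
  ∑ ℓ : Fin (m₁ + 1),
    Polynomial.C (coeffVar n₁ m₁ n₂ m₂ (Sum.inr (Sum.inl ℓ))) * Polynomial.X ^ (ℓ : ℕ)

/-- The generic polynomial `p₂ = ∑_{ℓ ≤ n₂} c_ℓ s^ℓ`. -/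
noncomputable def P2 (n₁ m₁ n₂ m₂ : ℕ) : Polynomial (Kc n₁ m₁ n₂ m₂) :=
  ∑ ℓ : Fin (n₂ + 1),
    Polynomial.C (coeffVar n₁ m₁ n₂ m₂ (Sum.inr (Sum.inr (Sum.inl ℓ)))) *
      Polynomial.X ^ (ℓ : ℕ)

/-- The generic polynomial `q₂ = ∑_{ℓ ≤ m₂} e_ℓ s^ℓ`. -/
noncomputable def Q2 (n₁ m₁ n₂ m₂ : ℕ) : Polynomial (Kc n₁ m₁ n₂ m₂) :=
  ∑ ℓ : Fin (m₂ + 1),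
    Polynomial.C (coeffVar n₁ m₁ n₂ m₂ (Sum.inr (Sum.inr (Sum.inr ℓ)))) *
      Polynomial.X ^ (ℓ : ℕ)

/-- The kernel-representation matrix of the series interconnection of two SISO
systems with transfer functions `q₁/p₁` and `q₂/p₂`:
rows `(q₁, −p₁, 0)` and `(0, q₂, −p₂)`. -/
noncomputable def Mser (n₁ m₁ n₂ m₂ : ℕ) :
    Matrix (Fin 2) (Fin 3) (Polynomial (Kc n₁ m₁ n₂ m₂)) :=
  !![Q1 n₁ m₁ n₂ m₂, -P1 n₁ m₁ n₂ m₂, 0;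
     0, Q2 n₁ m₁ n₂ m₂, -P2 n₁ m₁ n₂ m₂]

open Polynomial in
/-- The polynomial whose coefficients are the indeterminates `X (u 0), …, X (u n)`. -/
noncomputable def genericPoly {σ : Type*} (k : Type*) [CommRing k] {n : ℕ}
    (u : Fin (n + 1) → σ) : (MvPolynomial σ k)[X] :=
  ∑ l : Fin (n + 1), C (MvPolynomial.X (u l)) * X ^ (l : ℕ)

section genericPoly

open Polynomial

variable {σ k : Type*} [Field k] {n m : ℕ}

lemma natDegree_genericPoly_le (u : Fin (n + 1) → σ) :
    (genericPoly k u).natDegree ≤ n :=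
  natDegree_sum_le_of_forall_le _ _ fun l _ =>
    (natDegree_C_mul_X_pow_le _ _).trans (Nat.lt_succ_iff.mp l.isLt)

/-- Specializing one indeterminate to `1` and the others to `0`. -/
lemma map_genericPoly_eq_X_pow {u : Fin (n + 1) → σ} (φ : MvPolynomial σ k →+* k)
    (i : Fin (n + 1)) (h : ∀ l, φ (MvPolynomial.X (u l)) = if l = i then 1 else 0) :
    (genericPoly k u).map φ = X ^ (i : ℕ) := by
  simp [genericPoly, Polynomial.map_sum, h, apply_ite C]

lemma resultant_genericPoly_ne_zero {u : Fin (n + 1) → σ} {v : Fin (m + 1) → σ}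
    (hu : Function.Injective u) (hv : Function.Injective v) (huv : ∀ i j, u i ≠ v j) :
    resultant (genericPoly k u) (genericPoly k v) n m ≠ 0 := by
  classical
  let φ : MvPolynomial σ k →+* k :=
    MvPolynomial.eval fun x => if x = u (Fin.last n) ∨ x = v 0 then 1 else 0
  have h₁ : (genericPoly k u).map φ = X ^ n := by
    simpa using map_genericPoly_eq_X_pow φ (Fin.last n)
      fun l => by simp [φ, hu.eq_iff, huv]
  have h₂ : (genericPoly k v).map φ = 1 := by
    simpa using map_genericPoly_eq_X_pow φ 0
      fun l => by simp [φ, hv.eq_iff, (huv _ _).symm]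
  intro h
  have := resultant_map_map (genericPoly k u) (genericPoly k v) n m φ
  rw [h₁, h₂, h, map_zero, resultant_one_right, coeff_X_pow_self, one_pow] at this
  exact one_ne_zero this

lemma genericPoly_ne_zero {u : Fin (n + 1) → σ} (hu : Function.Injective u) :
    genericPoly k u ≠ 0 := by
  classical
  intro h
  have := map_genericPoly_eq_X_pow (k := k) (u := u)
    (MvPolynomial.eval fun x => if x = u 0 then 1 else 0) 0 fun l => by simp [hu.eq_iff]
  simp [h] at this

/-- Generic polynomials with disjoint sets of coefficients are coprime over any field
containing the coefficient ring. -/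
lemma isCoprime_map_genericPoly {K : Type*} [Field K] (ι : MvPolynomial σ k →+* K)
    (hι : Function.Injective ι) {u : Fin (n + 1) → σ} {v : Fin (m + 1) → σ}
    (hu : Function.Injective u) (hv : Function.Injective v) (huv : ∀ i j, u i ≠ v j) :
    IsCoprime ((genericPoly k u).map ι) ((genericPoly k v).map ι) := by
  by_cases hn : n = 0
  · obtain ⟨r, hr⟩ := natDegree_eq_zero.mp
      (Nat.le_zero.mp ((natDegree_genericPoly_le (k := k) u).trans_eq hn))
    have hr0 : ι r ≠ 0 := by
      rw [map_ne_zero_iff ι hι]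
      rintro rfl
      exact genericPoly_ne_zero hu (by rw [← hr, C_0])
    rw [← hr, map_C]
    obtain ⟨s, hs⟩ := (isUnit_C.mpr hr0.isUnit).exists_left_inv
    exact ⟨s, 0, by rw [hs, zero_mul, add_zero]⟩
  · obtain ⟨p, q, -, -, e⟩ := exists_mul_add_mul_eq_C_resultant _ _
      (natDegree_genericPoly_le (k := k) u) (natDegree_genericPoly_le (k := k) v) (Or.inl hn)
    have hres : ι (resultant (genericPoly k u) (genericPoly k v) n m) ≠ 0 :=
      (map_ne_zero_iff ι hι).mpr (resultant_genericPoly_ne_zero hu hv huv)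
    have e' := congrArg (Polynomial.map ι) e
    rw [Polynomial.map_add, Polynomial.map_mul, Polynomial.map_mul, map_C] at e'
    have hone := C_mul (a := (ι (resultant (genericPoly k u) (genericPoly k v) n m))⁻¹)
      (b := ι (resultant (genericPoly k u) (genericPoly k v) n m))
    rw [inv_mul_cancel₀ hres, C_1, ← e'] at hone
    exact ⟨C _ * p.map ι, C _ * q.map ι, by rw [hone]; ring⟩

end genericPoly

/-- The maximal minors of the matrix with rows `(a, -b, 0)` and `(0, c, -d)` generate the unit
ideal when the relevant pairs of entries are coprime. -/
lemma span_minors_series_eq_top {R : Type*} [CommRing R] {a b c d : R}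
    (hab : IsCoprime a b) (had : IsCoprime a d) (hcd : IsCoprime c d) :
    Ideal.span {q : R | ∃ f : Fin 2 → Fin 3, Function.Injective f ∧
      q = ((!![a, -b, 0; 0, c, -d] : Matrix (Fin 2) (Fin 3) R).submatrix id f).det} = ⊤ := by
  set I := Ideal.span {q : R | ∃ f : Fin 2 → Fin 3, Function.Injective f ∧
      q = ((!![a, -b, 0; 0, c, -d] : Matrix (Fin 2) (Fin 3) R).submatrix id f).det}
  have h₁ : a * c ∈ I := Ideal.subset_span ⟨![0, 1], by decide, by simp [Matrix.det_fin_two]⟩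
  have h₂ : a * d ∈ I := Ideal.subset_span ⟨![2, 0], by decide, by simp [Matrix.det_fin_two]⟩
  have h₃ : b * d ∈ I := Ideal.subset_span ⟨![1, 2], by decide, by simp [Matrix.det_fin_two]⟩
  obtain ⟨x, y, hxy⟩ := hcd
  have ha : a ∈ I := by
    have : a = x * (a * c) + y * (a * d) := by linear_combination (-a) * hxy
    rw [this]
    exact I.add_mem (I.mul_mem_left _ h₁) (I.mul_mem_left _ h₂)
  obtain ⟨z, w, hzw⟩ := hab.mul_right had
  rw [Ideal.eq_top_iff_one, ← hzw]
  exact I.add_mem (I.mul_mem_left _ ha) (I.mul_mem_left _ h₃)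

/-- The series interconnection: (a) no edge of the bipartite graph of `M_ser`
is redundant (every nonzero position lies in some `R`-saturating matching of
the support), and (b) the `2 × 2` minors of `M_ser` generate the unit ideal of
`K[s]`, i.e. the series interconnection is structurally controllable. -/
theorem series_interconnection_no_redundant_and_controllable (n₁ m₁ n₂ m₂ : ℕ) :
    (∀ (i : Fin 2) (j : Fin 3), Mser n₁ m₁ n₂ m₂ i j ≠ 0 →
      ∃ f : Fin 2 → Fin 3, Function.Injective f ∧
        (∀ k, Mser n₁ m₁ n₂ m₂ k (f k) ≠ 0) ∧ f i = j) ∧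
    Ideal.span {q : Polynomial (Kc n₁ m₁ n₂ m₂) | ∃ c : Fin 2 → Fin 3,
        Function.Injective c ∧
        q = ((Mser n₁ m₁ n₂ m₂).submatrix id c).det} = ⊤ := by
  let ι := algebraMap
    (MvPolynomial (Fin (n₁ + 1) ⊕ Fin (m₁ + 1) ⊕ Fin (n₂ + 1) ⊕ Fin (m₂ + 1)) ℝ)
    (Kc n₁ m₁ n₂ m₂)
  have hι : Function.Injective ι := IsFractionRing.injective _ _
  have hP₁ : P1 n₁ m₁ n₂ m₂ = (genericPoly ℝ Sum.inl).map ι := by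
    simp [P1, genericPoly, coeffVar, ι, Polynomial.map_sum]
  have hQ₁ : Q1 n₁ m₁ n₂ m₂ = (genericPoly ℝ (Sum.inr ∘ Sum.inl)).map ι := by
    simp [Q1, genericPoly, coeffVar, ι, Polynomial.map_sum]
  have hP₂ : P2 n₁ m₁ n₂ m₂ =
      (genericPoly ℝ (Sum.inr ∘ Sum.inr ∘ Sum.inl)).map ι := by
    simp [P2, genericPoly, coeffVar, ι, Polynomial.map_sum]
  have hQ₂ : Q2 n₁ m₁ n₂ m₂ =
      (genericPoly ℝ (Sum.inr ∘ Sum.inr ∘ Sum.inr)).map ι := by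
    simp [Q2, genericPoly, coeffVar, ι, Polynomial.map_sum]
  have iP₁ := Sum.inl_injective (α := Fin (n₁ + 1)) (β := Fin (m₁ + 1) ⊕ Fin (n₂ + 1) ⊕ Fin (m₂ + 1))
  have iQ₁ : Function.Injective
      (Sum.inr ∘ Sum.inl : _ → Fin (n₁ + 1) ⊕ Fin (m₁ + 1) ⊕ Fin (n₂ + 1) ⊕ Fin (m₂ + 1)) :=
    Sum.inr_injective.comp Sum.inl_injective
  have iP₂ : Function.Injective (Sum.inr ∘ Sum.inr ∘ Sum.inl :
      _ → Fin (n₁ + 1) ⊕ Fin (m₁ + 1) ⊕ Fin (n₂ + 1) ⊕ Fin (m₂ + 1)) :=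
    Sum.inr_injective.comp (Sum.inr_injective.comp Sum.inl_injective)
  have iQ₂ : Function.Injective (Sum.inr ∘ Sum.inr ∘ Sum.inr :
      _ → Fin (n₁ + 1) ⊕ Fin (m₁ + 1) ⊕ Fin (n₂ + 1) ⊕ Fin (m₂ + 1)) :=
    Sum.inr_injective.comp (Sum.inr_injective.comp Sum.inr_injective)
  have ne_zero {n : ℕ} {u : Fin (n + 1) → _} (hu : Function.Injective u) :
      (genericPoly ℝ u).map ι ≠ 0 :=
    (Polynomial.map_ne_zero_iff hι).mpr (genericPoly_ne_zero hu)
  have nP₁ : P1 n₁ m₁ n₂ m₂ ≠ 0 := hP₁ ▸ ne_zero iP₁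
  have nQ₁ : Q1 n₁ m₁ n₂ m₂ ≠ 0 := hQ₁ ▸ ne_zero iQ₁
  have nP₂ : P2 n₁ m₁ n₂ m₂ ≠ 0 := hP₂ ▸ ne_zero iP₂
  have nQ₂ : Q2 n₁ m₁ n₂ m₂ ≠ 0 := hQ₂ ▸ ne_zero iQ₂
  constructor
  · have matching {j₀ j₁ : Fin 3} (hj : j₀ ≠ j₁) (h₀ : Mser n₁ m₁ n₂ m₂ 0 j₀ ≠ 0)
        (h₁ : Mser n₁ m₁ n₂ m₂ 1 j₁ ≠ 0) :
        Function.Injective ![j₀, j₁] ∧ ∀ k, Mser n₁ m₁ n₂ m₂ k (![j₀, j₁] k) ≠ 0 :=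
      ⟨by simpa [Function.Injective, Fin.forall_fin_two, hj.symm] using hj,
        by simpa [Fin.forall_fin_two] using ⟨h₀, h₁⟩⟩
    have h01 := matching (j₀ := 0) (j₁ := 1) (by decide) (by simpa [Mser]) (by simpa [Mser])
    have h12 := matching (j₀ := 1) (j₁ := 2) (by decide) (by simpa [Mser]) (by simpa [Mser])
    intro i j hij
    fin_cases i <;> fin_cases j
    · exact ⟨_, h01.1, h01.2, rfl⟩
    · exact ⟨_, h12.1, h12.2, rfl⟩
    · simp [Mser] at hij
    · simp [Mser] at hij
    · exact ⟨_, h01.1, h01.2, rfl⟩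
    · exact ⟨_, h12.1, h12.2, rfl⟩
  · refine span_minors_series_eq_top ?_ ?_ ?_
    · rw [hQ₁, hP₁]
      exact isCoprime_map_genericPoly _ hι iQ₁ iP₁ (by simp)
    · rw [hQ₁, hP₂]
      exact isCoprime_map_genericPoly _ hι iQ₁ iP₂ (by simp)
    · rw [hQ₂, hP₂]
      exact isCoprime_map_genericPoly _ hι iQ₂ iP₂ (by simp)
end

section
/- Let p₁, q₁, p₂, q₂ be the generic real polynomials of degrees n₁, m₁, n₂, m₂ respectively (coefficients independent indeterminates, with K the fraction field of the coefficient ring), and let M_par ∈ K[s]^{3×4} be the matrix with rows (p₁, 0, −q₁, 0), (0, −p₂, q₂, 0), (1, 1, 0, −1) describing the parallel interconnection of two SISO systems with transfer functions q₁/p₁ and q₂/p₂. Then (a) every position (i,j) with nonzero entry of M_par belongs to some R-saturating matching of the support of M_par (no edge of the associated bipartite graph is redundant), and (b) the 3 × 3 minors of M_par generate the unit ideal of K[s], i.e., the parallel interconnection is structurally controllable. -/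
/-- The kernel-representation matrix of the parallel interconnection of two
SISO systems with transfer functions `q₁/p₁` and `q₂/p₂`:
rows `(p₁, 0, −q₁, 0)`, `(0, −p₂, q₂, 0)`, `(1, 1, 0, −1)`. -/
noncomputable def Mpar (n₁ m₁ n₂ m₂ : ℕ) :
    Matrix (Fin 3) (Fin 4) (Polynomial (Kc n₁ m₁ n₂ m₂)) :=
  !![P1 n₁ m₁ n₂ m₂, 0, -Q1 n₁ m₁ n₂ m₂, 0;
     0, -P2 n₁ m₁ n₂ m₂, Q2 n₁ m₁ n₂ m₂, 0;
     1, 1, 0, -1]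

open Polynomial in
/-- Over a field of characteristic zero, two polynomials are coprime if, for every natural number
`t`, some ring endomorphism of the field fixes the second and subtracts `t` from the first. -/
theorem Polynomial.isCoprime_of_forall_exists_map_eq_sub {F : Type*} [Field F] [CharZero F]
    {p q : F[X]} (hq : q ≠ 0)
    (h : ∀ t : ℕ, ∃ φ : F →+* F, p.map φ = p - (t : F[X]) ∧ q.map φ = q) :
    IsCoprime p q := by
  by_contra hpq
  have hroot : ∀ t : ℕ, ∃ x : AlgebraicClosure F,
      aeval x p = -(t : AlgebraicClosure F) ∧ aeval x q = 0 := by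
    intro t
    by_contra! hx
    obtain ⟨φ, hp, hφq⟩ := h t
    have hcop : IsCoprime (p + (t : F[X])) q := by
      rw [isCoprime_iff_aeval_ne_zero_of_isAlgClosed F (AlgebraicClosure F)]
      intro x
      by_cases hqx : aeval x q = 0
      · left
        intro h0
        refine hx x ?_ hqx
        rw [map_add, map_natCast] at h0
        exact eq_neg_of_add_eq_zero_left h0
      · exact Or.inr hqx
    have := hcop.map (mapRingHom φ)
    simp only [coe_mapRingHom, Polynomial.map_add, Polynomial.map_natCast, hp, hφq,
      sub_add_cancel] at this
    exact hpq this
  choose x hxp hxq using hroot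
  have hinj : Function.Injective x := by
    intro s t hst
    have := (hxp s).symm.trans (hst ▸ hxp t)
    exact_mod_cast neg_injective this
  refine Set.infinite_range_of_injective hinj ((q.rootSet_finite (AlgebraicClosure F)).subset ?_)
  rintro _ ⟨t, rfl⟩
  exact (mem_rootSet).2 ⟨hq, hxq t⟩

/-- Translation of a single indeterminate extends to the field of rational functions. -/
theorem MvPolynomial.exists_fractionRing_translate {σ k : Type*} [Field k] (i : σ) (t : k) :
    ∃ φ : FractionRing (MvPolynomial σ k) →+* FractionRing (MvPolynomial σ k),
      φ (algebraMap _ _ (X i : MvPolynomial σ k)) =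
        algebraMap _ _ (X i : MvPolynomial σ k) - algebraMap (MvPolynomial σ k) _ (C t) ∧
      ∀ j ≠ i, φ (algebraMap _ _ (X j : MvPolynomial σ k)) =
        algebraMap _ _ (X j : MvPolynomial σ k) := by
  classical
  let τ (u : k) : MvPolynomial σ k →ₐ[k] MvPolynomial σ k :=
    aeval fun j => if j = i then X j - C u else X j
  have hleft : (τ (-t)).comp (τ t) = AlgHom.id k _ := by
    ext j : 1
    by_cases hj : j = i <;> simp [τ, hj, MvPolynomial.algHom_C, MvPolynomial.algebraMap_eq]
  have hinj : Function.Injective (τ t : MvPolynomial σ k →+* MvPolynomial σ k) :=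
    Function.LeftInverse.injective (g := τ (-t)) fun y => DFunLike.congr_fun hleft y
  refine ⟨IsFractionRing.map hinj, ?_, fun j hj => ?_⟩
  · simp [IsFractionRing.map, IsLocalization.map_eq, τ]
  · simp [IsFractionRing.map, IsLocalization.map_eq, τ, hj]

/-- The polynomial of formal degree `n` whose coefficients are the indeterminates `v ℓ`. -/
noncomputable def genericPolynomial {σ : Type*} (k : Type*) [Field k] {n : ℕ}
    (v : Fin (n + 1) → σ) : Polynomial (FractionRing (MvPolynomial σ k)) :=
  ∑ ℓ : Fin (n + 1),
    Polynomial.C (algebraMap (MvPolynomial σ k) _ (MvPolynomial.X (v ℓ))) *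
      Polynomial.X ^ (ℓ : ℕ)

theorem genericPolynomial_ne_zero {σ : Type*} (k : Type*) [Field k] {n : ℕ}
    (v : Fin (n + 1) → σ) : genericPolynomial k v ≠ 0 := by
  intro h
  have h0 := congrArg (Polynomial.eval 0) h
  simp [genericPolynomial, Polynomial.eval_finsetSum, Fin.sum_univ_succ] at h0

/-- Generic polynomials with independent coefficients are coprime. -/
theorem isCoprime_genericPolynomial {σ : Type*} (k : Type*) [Field k] [CharZero k] {n m : ℕ}
    {v : Fin (n + 1) → σ} {w : Fin (m + 1) → σ} (hv : Function.Injective v)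
    (hvw : ∀ a b, w b ≠ v a) :
    IsCoprime (genericPolynomial k v) (genericPolynomial k w) := by
  have : CharZero (FractionRing (MvPolynomial σ k)) :=
    charZero_of_injective_algebraMap (IsFractionRing.injective (MvPolynomial σ k) _)
  refine Polynomial.isCoprime_of_forall_exists_map_eq_sub (genericPolynomial_ne_zero k w)
    fun t => ?_
  obtain ⟨φ, hi, hj⟩ := MvPolynomial.exists_fractionRing_translate (v 0) (t : k)
  refine ⟨φ, ?_, ?_⟩
  · have hs : ∀ ℓ : Fin n, φ (algebraMap _ _ (MvPolynomial.X (v ℓ.succ) : MvPolynomial σ k)) =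
        algebraMap _ _ (MvPolynomial.X (v ℓ.succ) : MvPolynomial σ k) :=
      fun ℓ => hj _ fun h => Fin.succ_ne_zero ℓ (hv h)
    simp only [genericPolynomial, Fin.sum_univ_succ, Polynomial.map_add, Polynomial.map_mul,
      Polynomial.map_sum, Polynomial.map_C, Polynomial.map_pow, Polynomial.map_X, hi, hs]
    simp
    ring
  · simp only [genericPolynomial, Polynomial.map_sum, Polynomial.map_mul, Polynomial.map_C,
      Polynomial.map_pow, Polynomial.map_X, hj _ (hvw 0 _)]

/-- The parallel interconnection: (a) no edge of the bipartite graph of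
`M_par` is redundant (every nonzero position lies in some `R`-saturating
matching of the support), and (b) the `3 × 3` minors of `M_par` generate the
unit ideal of `K[s]`, i.e. the parallel interconnection is structurally
controllable. -/
theorem parallel_interconnection_no_redundant_and_controllable (n₁ m₁ n₂ m₂ : ℕ) :
    (∀ (i : Fin 3) (j : Fin 4), Mpar n₁ m₁ n₂ m₂ i j ≠ 0 →
      ∃ f : Fin 3 → Fin 4, Function.Injective f ∧
        (∀ k, Mpar n₁ m₁ n₂ m₂ k (f k) ≠ 0) ∧ f i = j) ∧
    Ideal.span {q : Polynomial (Kc n₁ m₁ n₂ m₂) | ∃ c : Fin 3 → Fin 4,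
        Function.Injective c ∧
        q = ((Mpar n₁ m₁ n₂ m₂).submatrix id c).det} = ⊤ := by
  have hp₁ : P1 n₁ m₁ n₂ m₂ ≠ 0 := genericPolynomial_ne_zero ℝ Sum.inl
  have hq₁ : Q1 n₁ m₁ n₂ m₂ ≠ 0 := genericPolynomial_ne_zero ℝ (Sum.inr ∘ Sum.inl)
  have hp₂ : P2 n₁ m₁ n₂ m₂ ≠ 0 := genericPolynomial_ne_zero ℝ (Sum.inr ∘ Sum.inr ∘ Sum.inl)
  have hq₂ : Q2 n₁ m₁ n₂ m₂ ≠ 0 := genericPolynomial_ne_zero ℝ (Sum.inr ∘ Sum.inr ∘ Sum.inr)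
  have hp₁q₁ : IsCoprime (P1 n₁ m₁ n₂ m₂) (Q1 n₁ m₁ n₂ m₂) :=
    isCoprime_genericPolynomial ℝ (v := Sum.inl) (w := Sum.inr ∘ Sum.inl)
      Sum.inl_injective (by simp)
  have hp₁p₂ : IsCoprime (P1 n₁ m₁ n₂ m₂) (P2 n₁ m₁ n₂ m₂) :=
    isCoprime_genericPolynomial ℝ (v := Sum.inl) (w := Sum.inr ∘ Sum.inr ∘ Sum.inl)
      Sum.inl_injective (by simp)
  have hp₂q₂ : IsCoprime (P2 n₁ m₁ n₂ m₂) (Q2 n₁ m₁ n₂ m₂) :=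
    isCoprime_genericPolynomial ℝ (v := Sum.inr ∘ Sum.inr ∘ Sum.inl)
      (w := Sum.inr ∘ Sum.inr ∘ Sum.inr)
      (Sum.inr_injective.comp (Sum.inr_injective.comp Sum.inl_injective)) (by simp)
  constructor
  · have key : ∀ f : Fin 3 → Fin 4, Function.Injective f →
        (∀ k, Mpar n₁ m₁ n₂ m₂ k (f k) ≠ 0) → ∀ i j, f i = j →
        ∃ f : Fin 3 → Fin 4, Function.Injective f ∧
          (∀ k, Mpar n₁ m₁ n₂ m₂ k (f k) ≠ 0) ∧ f i = j :=
      fun f hf hM i j hij => ⟨f, hf, hM, hij⟩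
    have h₀₁₃ := key ![0, 1, 3] (by decide) (by simp [Fin.forall_fin_succ, Mpar, hp₁, hp₂])
    have h₂₁₃ := key ![2, 1, 3] (by decide) (by simp [Fin.forall_fin_succ, Mpar, hq₁, hp₂])
    have h₀₂₃ := key ![0, 2, 3] (by decide) (by simp [Fin.forall_fin_succ, Mpar, hp₁, hq₂])
    have h₂₁₀ := key ![2, 1, 0] (by decide) (by simp [Fin.forall_fin_succ, Mpar, hq₁, hp₂])
    have h₀₂₁ := key ![0, 2, 1] (by decide) (by simp [Fin.forall_fin_succ, Mpar, hp₁, hq₂])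
    intro i j hij
    fin_cases i <;> fin_cases j
    all_goals first
      | exact h₀₁₃ _ _ rfl
      | exact h₂₁₃ _ _ rfl
      | exact h₀₂₃ _ _ rfl
      | exact h₂₁₀ _ _ rfl
      | exact h₀₂₁ _ _ rfl
      | exact absurd rfl hij
  · set I := Ideal.span {q : Polynomial (Kc n₁ m₁ n₂ m₂) | ∃ c : Fin 3 → Fin 4,
        Function.Injective c ∧ q = ((Mpar n₁ m₁ n₂ m₂).submatrix id c).det}
    have hp₁p₂I : P1 n₁ m₁ n₂ m₂ * P2 n₁ m₁ n₂ m₂ ∈ I :=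
      Ideal.subset_span ⟨![0, 1, 3], by decide, by simp [Matrix.det_fin_three, Mpar]; ring⟩
    have hp₁q₂I : -(P1 n₁ m₁ n₂ m₂ * Q2 n₁ m₁ n₂ m₂) ∈ I :=
      Ideal.subset_span ⟨![0, 2, 3], by decide, by simp [Matrix.det_fin_three, Mpar]; ring⟩
    have hq₁p₂I : Q1 n₁ m₁ n₂ m₂ * P2 n₁ m₁ n₂ m₂ ∈ I :=
      Ideal.subset_span ⟨![1, 2, 3], by decide, by simp [Matrix.det_fin_three, Mpar]; ring⟩
    have hp₁I : P1 n₁ m₁ n₂ m₂ ∈ I := by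
      obtain ⟨a, b, hab⟩ := hp₂q₂
      convert I.sub_mem (I.mul_mem_left a hp₁p₂I) (I.mul_mem_left b hp₁q₂I) using 1
      linear_combination -P1 n₁ m₁ n₂ m₂ * hab
    obtain ⟨a, b, hab⟩ := hp₁q₁.mul_right hp₁p₂
    rw [Ideal.eq_top_iff_one, ← hab]
    exact I.add_mem (I.mul_mem_left a hp₁I) (I.mul_mem_left b hq₁p₂I)
end

section
/- Let n ≥ 1 and let a : Fin n → ℝ with a j ≠ 0 for every j. Let M(s) = [s·1 − A | B] ∈ ℝ[s]^{n×(n+1)} where A is the companion matrix with superdiagonal entries 1 and last row (−a₀, …, −a_{n−1}) and B = (0,…,0,1)ᵀ. Let S ⊆ Fin n × Fin (n+1) be the set of positions at which M(s) has a nonzero entry. Then no edge of S is redundant: for every (i,j) ∈ S there exists an injective map f : Fin n → Fin (n+1) with f i = j and (k, f k) ∈ S for all k. -/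
/-- For the controller canonical form with all parameters `a j ≠ 0`, no edge
of the bipartite graph of `M(s) = [s·1 − A | B] ∈ ℝ[s]^{n×(n+1)}` is
redundant: for every position `(i, j)` at which `M` has a nonzero entry there
is an injective `f : Fin n → Fin (n+1)` with `f i = j` and `(k, f k)` a
nonzero position of `M` for all `k` (an `R`-saturating matching through
`(i, j)`). -/
theorem controller_canonical_form_no_redundant_edges {n : ℕ} (hn : 1 ≤ n)
    (a : Fin n → ℝ) (ha : ∀ j, a j ≠ 0)
    (A : Matrix (Fin n) (Fin n) ℝ)
    (hA : ∀ i j, A i j =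
      if (i : ℕ) = n - 1 then -a j
      else if (j : ℕ) = (i : ℕ) + 1 then 1 else 0)
    (B : Fin n → ℝ)
    (hB : ∀ i, B i = if (i : ℕ) = n - 1 then 1 else 0)
    (M : Matrix (Fin n) (Fin (n + 1)) (Polynomial ℝ))
    (hM : ∀ (i : Fin n) (j : Fin (n + 1)), M i j =
      if h : (j : ℕ) < n then
        (if (i : ℕ) = (j : ℕ) then Polynomial.X else 0) -
          Polynomial.C (A i ⟨(j : ℕ), h⟩)
      else Polynomial.C (B i)) :
    ∀ (i : Fin n) (j : Fin (n + 1)), M i j ≠ 0 →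
      ∃ f : Fin n → Fin (n + 1), Function.Injective f ∧ f i = j ∧
        ∀ k, M k (f k) ≠ 0 := by
  have last_ne_zero : ∀ (i : Fin n) (j : Fin (n + 1)), (i : ℕ) = n - 1 → M i j ≠ 0 := by
    intro i j hi
    rw [hM]
    split_ifs with hj hij
    · rw [hA, if_pos hi, Polynomial.C_neg, sub_neg_eq_add]
      exact Polynomial.X_add_C_ne_zero _
    · rw [hA, if_pos hi, zero_sub, neg_ne_zero, Polynomial.C_ne_zero]
      exact neg_ne_zero.mpr (ha _)
    · rw [hB, if_pos hi]
      simp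
  have diag_ne_zero : ∀ k : Fin n, M k k.castSucc ≠ 0 := by
    intro k
    have hlt : (k.castSucc : ℕ) < n := k.isLt
    rw [hM, dif_pos hlt]
    simpa using Polynomial.X_sub_C_ne_zero _
  have superdiag_ne_zero : ∀ k : Fin n, M k k.succ ≠ 0 := by
    intro k
    by_cases hk : (k : ℕ) = n - 1
    · exact last_ne_zero k _ hk
    · have hlt : (k.succ : ℕ) < n := by simp only [Fin.val_succ]; omega
      rw [hM, dif_pos hlt, hA, if_neg hk]
      simp
  intro i j hij
  by_cases hi : (i : ℕ) = n - 1
  · refine ⟨fun k => if (k : ℕ) = n - 1 then j else j.succAbove k, ?_, if_pos hi, ?_⟩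
    · intro k l hkl
      dsimp only at hkl
      split_ifs at hkl with hk hl hl
      · exact Fin.ext (hk.trans hl.symm)
      · exact absurd hkl.symm (Fin.succAbove_ne j l)
      · exact absurd hkl (Fin.succAbove_ne j k)
      · exact Fin.succAbove_right_injective hkl
    · intro k
      dsimp only
      split_ifs with hk
      · exact last_ne_zero k j hk
      · rw [Fin.succAbove]
        split_ifs
        · exact diag_ne_zero k
        · exact superdiag_ne_zero k
  · have hj : j = i.castSucc ∨ j = i.succ := by
      by_contra! h
      have h₁ : (i : ℕ) ≠ j := fun e => h.1 (Fin.ext e.symm)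
      have h₂ : (j : ℕ) ≠ i + 1 := fun e => h.2 (Fin.ext e)
      apply hij
      rw [hM]
      split_ifs
      · rw [hA, if_neg hi, if_neg h₂]
        simp
      · rw [hB, if_neg hi, Polynomial.C_0]
    rcases hj with rfl | rfl
    · exact ⟨Fin.castSucc, Fin.castSucc_injective n, rfl, diag_ne_zero⟩
    · exact ⟨Fin.succ, Fin.succ_injective n, rfl, superdiag_ne_zero⟩
end

section
/- Let m, n ∈ ℕ and let p = ∑_{i=0}^{m} X_i s^i and q = ∑_{j=0}^{n} Y_j s^j be the generic polynomials whose coefficients X₀,…,X_m, Y₀,…,Y_n are independent indeterminates, regarded as elements of K[s] where K is the field of fractions of the polynomial ring ℝ[X₀,…,X_m,Y₀,…,Y_n]. Then p and q are coprime in K[s]. (Two nonzero polynomials are generically coprime.) -/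
open Polynomial in
/-- Polynomials with nonzero resultant over a domain, taken with respect to degree bounds that are
not both zero, become coprime over any field containing the domain. -/
lemma isCoprime_map_of_resultant_ne_zero {R K : Type*} [CommRing R] [Field K] {φ : R →+* K}
    (hφ : Function.Injective φ) {f g : R[X]} {m n : ℕ} (hf : f.natDegree ≤ m)
    (hg : g.natDegree ≤ n) (hmn : m ≠ 0 ∨ n ≠ 0) (h : f.resultant g m n ≠ 0) :
    IsCoprime (f.map φ) (g.map φ) := by
  obtain ⟨u, v, -, -, huv⟩ := exists_mul_add_mul_eq_C_resultant f g hf hg hmn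
  have hr : φ (f.resultant g m n) ≠ 0 := (map_ne_zero_iff φ hφ).mpr h
  refine ⟨C (φ (f.resultant g m n))⁻¹ * u.map φ, C (φ (f.resultant g m n))⁻¹ * v.map φ, ?_⟩
  have huv' := congrArg (Polynomial.map φ) huv
  simp only [Polynomial.map_add, Polynomial.map_mul, map_C] at huv'
  calc _ = C (φ (f.resultant g m n))⁻¹ * (f.map φ * u.map φ + g.map φ * v.map φ) := by ring
    _ = 1 := by rw [huv', ← C_mul, inv_mul_cancel₀ hr, C_1]

open Polynomial in
/-- The resultant of two generic polynomials is nonzero. -/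
lemma resultant_generic_ne_zero (R : Type*) [CommRing R] [Nontrivial R] (m n : ℕ) :
    resultant
      (∑ i : Fin (m + 1),
        C (MvPolynomial.X (Sum.inl i) : MvPolynomial (Fin (m + 1) ⊕ Fin (n + 1)) R) * X ^ (i : ℕ))
      (∑ j : Fin (n + 1),
        C (MvPolynomial.X (Sum.inr j) : MvPolynomial (Fin (m + 1) ⊕ Fin (n + 1)) R) * X ^ (j : ℕ))
      m n ≠ 0 := by
  intro h
  -- Specialize the two polynomials to `X ^ m` and `1`.
  let φ : MvPolynomial (Fin (m + 1) ⊕ Fin (n + 1)) R →+* R :=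
    MvPolynomial.eval (Sum.elim (Pi.single (Fin.last m) 1) (Pi.single 0 1))
  have hf : (∑ i : Fin (m + 1), C (MvPolynomial.X (Sum.inl i) :
      MvPolynomial (Fin (m + 1) ⊕ Fin (n + 1)) R) * X ^ (i : ℕ)).map φ = X ^ m := by
    simp [φ, Polynomial.map_sum, Pi.single_apply]
  have hg : (∑ j : Fin (n + 1), C (MvPolynomial.X (Sum.inr j) :
      MvPolynomial (Fin (m + 1) ⊕ Fin (n + 1)) R) * X ^ (j : ℕ)).map φ = 1 := by
    simp [φ, Polynomial.map_sum, Pi.single_apply]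
  have h' := congrArg φ h
  rw [← resultant_map_map, hf, hg] at h'
  simp at h'

/-- Two generic nonzero polynomials are coprime: if
`p = ∑_{i ≤ m} X_i s^i` and `q = ∑_{j ≤ n} Y_j s^j` have independent
indeterminate coefficients, viewed over the fraction field `K` of
`ℝ[X₀,…,X_m,Y₀,…,Y_n]`, then `p` and `q` are coprime in `K[s]`. -/
theorem generic_polynomials_coprime (m n : ℕ) :
    IsCoprime
      (∑ i : Fin (m + 1),
        Polynomial.C
          ((algebraMap (MvPolynomial (Fin (m + 1) ⊕ Fin (n + 1)) ℝ)
              (FractionRing (MvPolynomial (Fin (m + 1) ⊕ Fin (n + 1)) ℝ)))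
            (MvPolynomial.X (Sum.inl i))) * Polynomial.X ^ (i : ℕ))
      (∑ j : Fin (n + 1),
        Polynomial.C
          ((algebraMap (MvPolynomial (Fin (m + 1) ⊕ Fin (n + 1)) ℝ)
              (FractionRing (MvPolynomial (Fin (m + 1) ⊕ Fin (n + 1)) ℝ)))
            (MvPolynomial.X (Sum.inr j))) * Polynomial.X ^ (j : ℕ)) := by
  rcases eq_or_ne m 0 with rfl | hm
  · refine isCoprime_one_left.of_isCoprime_of_dvd_left (IsUnit.dvd ?_)
    simp [MvPolynomial.X_ne_zero]
  · have h := isCoprime_map_of_resultant_ne_zero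
      (IsFractionRing.injective (MvPolynomial (Fin (m + 1) ⊕ Fin (n + 1)) ℝ)
        (FractionRing (MvPolynomial (Fin (m + 1) ⊕ Fin (n + 1)) ℝ)))
      (Polynomial.natDegree_sum_le_of_forall_le _ _ fun i _ ↦
        (Polynomial.natDegree_C_mul_X_pow_le _ _).trans (Nat.lt_succ_iff.mp i.isLt))
      (Polynomial.natDegree_sum_le_of_forall_le _ _ fun j _ ↦
        (Polynomial.natDegree_C_mul_X_pow_le _ _).trans (Nat.lt_succ_iff.mp j.isLt))
      (Or.inl hm) (resultant_generic_ne_zero ℝ m n)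
    simpa [Polynomial.map_sum] using h
end

section
/- Fix a support S ⊆ Fin p × Fin v and let A ∈ K^{p×v} be the generic matrix with A i j = X_{ij} (independent indeterminates) for (i,j) ∈ S and A i j = 0 otherwise, where K is the field of fractions of the multivariate polynomial ring over ℝ in the variables X_{ij}, (i,j) ∈ S. Then the rank of A over K equals the term rank of S, i.e., the maximum size of a matching in S (the largest t for which there exist t positions in S with pairwise distinct rows and pairwise distinct columns). -/
open Classical in
/-- The generic matrix with support `S`: its `(i,j)` entry is the independent
indeterminate `X_{ij}` (viewed in the fraction field `K` of the multivariate
polynomial ring over `ℝ` with one indeterminate per position of `S`) when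
`(i,j) ∈ S`, and `0` otherwise. -/
noncomputable def genericSupportMatrix {p v : ℕ} (S : Set (Fin p × Fin v)) :
    Matrix (Fin p) (Fin v) (FractionRing (MvPolynomial S ℝ)) :=
  fun i j =>
    if h : (i, j) ∈ S then
      algebraMap (MvPolynomial S ℝ) (FractionRing (MvPolynomial S ℝ))
        (MvPolynomial.X (⟨(i, j), h⟩ : S))
    else 0

namespace Matrix

theorem exists_submatrix_linearIndependent_row {m n F : Type*} [Fintype m] [Fintype n] [Field F]
    (A : Matrix m n F) {k : ℕ} (hk : A.rank = k) :
    ∃ r : Fin k → m, LinearIndependent F (A.submatrix r id).row := by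
  rw [rank_eq_finrank_span_row] at hk
  subst hk
  obtain ⟨f, hf, -, hli⟩ := Submodule.exists_fun_fin_finrank_span_eq F (Set.range A.row)
  choose r hr using hf
  refine ⟨r, ?_⟩
  rwa [show (A.submatrix r id).row = f from funext hr]

/-- A matrix over a field has a nonsingular square submatrix whose size is its rank. -/
theorem exists_submatrix_det_ne_zero {m n F : Type*} [Fintype m] [Fintype n] [Field F]
    (A : Matrix m n F) :
    ∃ (r : Fin A.rank → m) (c : Fin A.rank → n), (A.submatrix r c).det ≠ 0 := by
  obtain ⟨r, hr⟩ := A.exists_submatrix_linearIndependent_row rfl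
  have hrank : (A.submatrix r id)ᵀ.rank = A.rank := by
    rw [rank_transpose, hr.rank_matrix, Fintype.card_fin]
  obtain ⟨c, hc⟩ := exists_submatrix_linearIndependent_row _ hrank
  refine ⟨r, c, ?_⟩
  rw [← det_transpose]
  exact ((isUnit_iff_isUnit_det _).mp (linearIndependent_rows_iff_isUnit.mp hc)).ne_zero

/-- A nonsingular submatrix contains a transversal of nonzero entries. -/
theorem exists_matching_of_submatrix_det_ne_zero {m n F : Type*} [Field F] {k : ℕ}
    (A : Matrix m n F)
    {r : Fin k → m} {c : Fin k → n} (h : (A.submatrix r c).det ≠ 0) :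
    ∃ T : Finset (m × n), (∀ e ∈ T, A e.1 e.2 ≠ 0) ∧
      (∀ e ∈ T, ∀ e' ∈ T, e ≠ e' → e.1 ≠ e'.1 ∧ e.2 ≠ e'.2) ∧ T.card = k := by
  classical
  have hr : Function.Injective r := fun i j hij => by
    by_contra hne
    exact h (det_zero_of_row_eq hne (by ext; simp [hij]))
  have hc : Function.Injective c := fun i j hij => by
    by_contra hne
    exact h (det_zero_of_column_eq hne (by simp [hij]))
  rw [det_apply] at h
  obtain ⟨σ, -, hσ⟩ := Finset.exists_ne_zero_of_sum_ne_zero h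
  have hprod : ∏ i, (A.submatrix r c) (σ i) i ≠ 0 := fun h0 => hσ (by rw [h0, smul_zero])
  rw [Finset.prod_ne_zero_iff] at hprod
  refine ⟨Finset.univ.image fun i => (r (σ i), c i), ?_, ?_, ?_⟩
  · simpa using hprod
  · simp only [Finset.mem_image, Finset.mem_univ, true_and]
    rintro _ ⟨i, rfl⟩ _ ⟨j, rfl⟩ hne
    have hij : i ≠ j := by
      rintro rfl
      exact hne rfl
    exact ⟨(hr.comp σ.injective).ne hij, hc.ne hij⟩
  · rw [Finset.card_image_of_injective _ fun i j hij => hc (Prod.ext_iff.mp hij).2,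
      Finset.card_univ, Fintype.card_fin]

end Matrix

theorem mem_of_genericSupportMatrix_ne_zero {p v : ℕ} {S : Set (Fin p × Fin v)}
    {e : Fin p × Fin v} (h : genericSupportMatrix S e.1 e.2 ≠ 0) : e ∈ S := by
  by_contra he
  exact h (dif_neg he)

/-- Specializing the indeterminates to the indicator of a matching yields an identity submatrix,
so the size of a matching is at most the generic rank. -/
theorem card_le_rank_genericSupportMatrix {p v : ℕ} {S : Set (Fin p × Fin v)}
    {T : Finset (Fin p × Fin v)} (hTS : ↑T ⊆ S)
    (hT : ∀ e ∈ T, ∀ e' ∈ T, e ≠ e' → e.1 ≠ e'.1 ∧ e.2 ≠ e'.2) :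
    T.card ≤ (genericSupportMatrix S).rank := by
  classical
  let B : Matrix T T (MvPolynomial S ℝ) := .of fun e e' =>
    if h : (e.1.1, e'.1.2) ∈ S then MvPolynomial.X ⟨_, h⟩ else 0
  let φ : MvPolynomial S ℝ →+* ℝ := MvPolynomial.eval fun s : S => if s.1 ∈ T then 1 else 0
  have hφ : φ.mapMatrix B = 1 := by
    ext e e'
    have hmem : (e.1.1, e'.1.2) ∈ T ↔ e = e' := by
      constructor
      · intro h
        have h1 : (e.1.1, e'.1.2) = e.1 := by
          by_contra hne
          exact (hT _ h _ e.2 hne).1 rfl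
        have h2 : (e.1.1, e'.1.2) = e'.1 := by
          by_contra hne
          exact (hT _ h _ e'.2 hne).2 rfl
        exact Subtype.ext (h1.symm.trans h2)
      · rintro rfl
        exact e.2
    by_cases h : (e.1.1, e'.1.2) ∈ S
    · simp [B, φ, h, hmem, Matrix.one_apply]
    · have hne : e ≠ e' := fun he => h (hTS (hmem.mpr he))
      simp [B, h, hne]
  have hB : B.det ≠ 0 := by
    intro h0
    have := φ.map_det B
    rw [hφ, h0, map_zero, Matrix.det_one] at this
    exact zero_ne_one this
  have hsub : (genericSupportMatrix S).submatrix (fun e : T => e.1.1) (fun e : T => e.1.2) =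
      (algebraMap (MvPolynomial S ℝ) (FractionRing (MvPolynomial S ℝ))).mapMatrix B := by
    ext e e'
    by_cases h : (e.1.1, e'.1.2) ∈ S <;> simp [genericSupportMatrix, B, h]
  have hdet : ((genericSupportMatrix S).submatrix
      (fun e : T => e.1.1) (fun e : T => e.1.2)).det ≠ 0 := by
    rw [hsub, ← RingHom.map_det]
    exact (map_ne_zero_iff _ (IsFractionRing.injective _ _)).mpr hB
  have hrank := Matrix.rank_of_det_ne_zero hdet
  rw [Fintype.card_coe] at hrank
  exact hrank ▸ Matrix.rank_submatrix_le _ _ _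

/-- The rank over `K` of the generic matrix with support `S` equals the term
rank of `S`: the maximum size of a matching in `S`, i.e. the largest `t` for
which there exist `t` positions in `S` with pairwise distinct rows and
pairwise distinct columns. -/
theorem generic_rank_eq_term_rank {p v : ℕ} (S : Set (Fin p × Fin v)) :
    (genericSupportMatrix S).rank =
      sSup {t : ℕ | ∃ T : Finset (Fin p × Fin v), ↑T ⊆ S ∧
        (∀ e ∈ T, ∀ e' ∈ T, e ≠ e' → e.1 ≠ e'.1 ∧ e.2 ≠ e'.2) ∧
        T.card = t} := by
  symm
  apply IsGreatest.csSup_eq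
  constructor
  · obtain ⟨r, c, h⟩ := (genericSupportMatrix S).exists_submatrix_det_ne_zero
    obtain ⟨T, hne, hT, hcard⟩ := Matrix.exists_matching_of_submatrix_det_ne_zero _ h
    exact ⟨T, fun e he => mem_of_genericSupportMatrix_ne_zero (hne e he), hT, hcard⟩
  · rintro _ ⟨T, hTS, hT, rfl⟩
    exact card_le_rank_genericSupportMatrix hTS hT
end
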